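/- The sequence of Mersenne numbers {M_n}, where M_n = 2^{p_n} - 1 and p_n is the n-th prime, is Benford distributed; that is, for every digit d ∈ {1,...,9}, lim_{N→∞} (1/N)·#{n ≤ N : D(M_n) = d} = log_{10}(1 + 1/d). -/

import Mathlib

open Filter

/-- `x` has leading digit `d` in base 10: `d·10^k ≤ x < (d+1)·10^k` for some integer `k`. -/
def HasLeadingDigit (x : ℝ) (d : ℕ) : Prop :=
  ∃ k : ℤ, (d : ℝ) * 10 ^ k ≤ x ∧ x < ((d : ℝ) + 1) * 10 ^ k

/-- The Benford frequency `P(d) = log₁₀ (1 + 1/d)` of digit `d`. -/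
noncomputable def benfordP (d : ℕ) : ℝ := Real.logb 10 (1 + 1 / (d : ℝ))

/-- A sequence is Benford distributed if for each digit `d ∈ {1,…,9}` the density of
indices `n` with `D(a_n) = d` equals `P(d)`. -/
def BenfordDistributed (a : ℕ → ℝ) : Prop :=
  ∀ d : ℕ, 1 ≤ d → d ≤ 9 →
    Tendsto
      (fun N : ℕ =>
        (Nat.card {n : ℕ | 1 ≤ n ∧ n ≤ N ∧ HasLeadingDigit (a n) d} : ℝ) / N)
      atTop (nhds (benfordP d))

/-- A sequence is locally Benford distributed of order `k` if every `k`-tuple of digits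
in `{1,…,9}` occurs among leading digits of `k` consecutive terms with density
`P(d₀)⋯P(d_{k-1})`. -/
def LocallyBenfordDistributed (a : ℕ → ℝ) (k : ℕ) : Prop :=
  ∀ d : Fin k → ℕ, (∀ i, 1 ≤ d i ∧ d i ≤ 9) →
    Tendsto
      (fun N : ℕ =>
        (Nat.card {n : ℕ | 1 ≤ n ∧ n ≤ N ∧
            ∀ i : Fin k, HasLeadingDigit (a (n + (i : ℕ))) (d i)} : ℝ) / N)
      atTop (nhds (∏ i : Fin k, benfordP (d i)))

/-- `waitingTime a d i` is the waiting time `w_i(d) = n_{i+1}^{(d)} - n_i^{(d)}`, where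
`n_1^{(d)} < n_2^{(d)} < ⋯` enumerates `{n ∈ ℕ, n ≥ 1 : D(a_n) = d}`
(the `j`-th element of this set, 1-indexed, being `Nat.nth · (j-1)`). -/
noncomputable def waitingTime (a : ℕ → ℝ) (d : ℕ) (i : ℕ) : ℕ :=
  Nat.nth (fun n => 1 ≤ n ∧ HasLeadingDigit (a n) d) i -
    Nat.nth (fun n => 1 ≤ n ∧ HasLeadingDigit (a n) d) (i - 1)

/-- A sequence has Benford distributed waiting times if for each digit `d ∈ {1,…,9}`
the waiting times between occurrences of leading digit `d` take value `k` with density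
`P(d)(1-P(d))^{k-1}`. -/
def BenfordWaitingTimes (a : ℕ → ℝ) : Prop :=
  ∀ d : ℕ, 1 ≤ d → d ≤ 9 → ∀ k : ℕ, 1 ≤ k →
    Tendsto
      (fun N : ℕ =>
        (Nat.card {i : ℕ | 1 ≤ i ∧ i ≤ N ∧ waitingTime a d i = k} : ℝ) / N)
      atTop (nhds (benfordP d * (1 - benfordP d) ^ (k - 1)))

/-- A sequence `u` of real numbers is uniformly distributed modulo 1. -/
def UniformlyDistributedMod1 (u : ℕ → ℝ) : Prop :=
  ∀ t : ℝ, 0 ≤ t → t ≤ 1 →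
    Tendsto
      (fun N : ℕ =>
        (Nat.card {n : ℕ | 1 ≤ n ∧ n ≤ N ∧ Int.fract (u n) ≤ t} : ℝ) / N)
      atTop (nhds t)

/-- `nthPrime n` is the `n`-th prime (1-indexed): `nthPrime 1 = 2`, `nthPrime 2 = 3`, … -/
noncomputable def nthPrime (n : ℕ) : ℕ := Nat.nth Nat.Prime (n - 1)

lemma poly_ratio (Q : Polynomial ℝ) (hQ : Q ≠ 0) (c : ℝ) :
    Tendsto (fun x : ℝ => Q.eval (x + c) / Q.eval x) atTop (nhds 1) := by
  have h := Polynomial.div_tendsto_atTop_leadingCoeff_div_of_degree_eq (Polynomial.taylor c Q) Q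
    (by simp)
  have h2 : (Polynomial.taylor c Q).leadingCoeff / Q.leadingCoeff = 1 := by
    simp [hQ]
  rw [h2] at h
  simpa [Polynomial.taylor_eval, add_comm] using h

lemma zero_est (K L R S b1 b2 : ℕ) (p : ℕ → ℕ → ℤ) (hne : ∃ k < K, ∃ l < L, p k l ≠ 0)
    (hco : Nat.Coprime b1 b2) (hS : S ≤ b2) (hb2 : 0 < b2) (hRS : K * L ≤ R * S)
    (hz : ∀ r < R + L, ∀ s < S, ∑ k ∈ Finset.range K, ∑ l ∈ Finset.range L,
      (p k l : ℝ) * ((r * b2 + s * b1 : ℕ) : ℝ) ^ k * ((2:ℝ) ^ r * 5 ^ s) ^ l = 0) : False := by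
  classical
  let Q : ℕ → Polynomial ℝ := fun l => ∑ k ∈ Finset.range K, Polynomial.monomial k (p k l : ℝ)
  have hQe : ∀ l x, (Q l).eval x = ∑ k ∈ Finset.range K, (p k l : ℝ) * x ^ k := by
    intro l x
    simp [Q, Polynomial.eval_finsetSum]
  have hK : 0 < K := by obtain ⟨k, hk, _⟩ := hne; omega
  have hQd : ∀ l, (Q l).natDegree ≤ K - 1 := by
    intro l
    apply Polynomial.natDegree_sum_le_of_forall_le
    intro k hk
    refine (Polynomial.natDegree_monomial_le _).trans ?_
    have := Finset.mem_range.1 hk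
    omega
  let supp := (Finset.range L).filter (fun l => Q l ≠ 0)
  have hsuppne : supp.Nonempty := by
    obtain ⟨k, hk, l, hl, hkl⟩ := hne
    refine ⟨l, by
      simp only [supp, Finset.mem_filter, Finset.mem_range]
      refine ⟨hl, fun h0 => hkl ?_⟩
      have : (Q l).coeff k = p k l := by
        simp [Q, Polynomial.coeff_monomial, hk]
      rw [h0] at this
      simpa using this.symm⟩
  obtain ⟨n, hn⟩ : ∃ n, supp.card = n := ⟨_, rfl⟩
  have hn1 : 1 ≤ n := by rw [← hn]; exact hsuppne.card_pos
  have hnL : n ≤ L := by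
    rw [← hn]; exact (Finset.card_filter_le _ _).trans (by simp)
  let e := supp.orderEmbOfFin hn
  have hemem : ∀ i, e i ∈ supp := fun i => Finset.orderEmbOfFin_mem _ _ _
  have hQne : ∀ i, Q (e i) ≠ 0 := fun i => (Finset.mem_filter.1 (hemem i)).2
  let M : Matrix (Fin n) (Fin n) (Polynomial ℝ) := fun i j =>
    Polynomial.C (((2:ℝ) ^ (e i)) ^ (j:ℕ)) * Polynomial.taylor ((j:ℕ) * b2 : ℝ) (Q (e i))
  have hMeval : ∀ (x : ℝ) i j, (M i j).eval x =
      ((2:ℝ) ^ (e i)) ^ (j:ℕ) * (Q (e i)).eval (x + (j:ℕ) * b2) := by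
    intro x i j
    simp [M, Polynomial.taylor_eval, add_comm]
  have hdeg : M.det.natDegree ≤ n * (K - 1) := by
    rw [Matrix.det_apply]
    apply Polynomial.natDegree_sum_le_of_forall_le
    intro σ _
    refine (Polynomial.natDegree_smul_le _ _).trans ?_
    refine (Polynomial.natDegree_prod_le _ _).trans ?_
    calc _ ≤ ∑ i : Fin n, (K - 1) := by
          apply Finset.sum_le_sum
          intro i _
          simp only [M]
          refine (Polynomial.natDegree_C_mul_le _ _).trans ?_
          simpa using hQd _
      _ = _ := by simp
  have hroot : ∀ r < R, ∀ s < S, M.det.eval ((r * b2 + s * b1 : ℕ) : ℝ) = 0 := by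
    intro r hr s hs
    set x0 : ℝ := ((r * b2 + s * b1 : ℕ) : ℝ) with hx0
    have h1 : M.det.eval x0 = (M.map (Polynomial.eval x0)).det := by
      have := RingHom.map_det (Polynomial.evalRingHom x0) M
      simpa using this
    rw [h1]
    apply Matrix.exists_vecMul_eq_zero_iff.1
    refine ⟨fun i => ((2:ℝ) ^ r * 5 ^ s) ^ (e i), ?_, ?_⟩
    · intro h
      have := congrFun h ⟨0, hn1⟩
      simp at this
    · ext j
      simp only [Matrix.vecMul, dotProduct, Matrix.map_apply, Pi.zero_apply, hMeval]
      have hj := hz (r + j) (by have := j.2; omega) s hs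
      rw [Finset.sum_comm] at hj
      have h3 : ∀ l ∈ Finset.range L, ∑ k ∈ Finset.range K,
          (p k l : ℝ) * (((r + j) * b2 + s * b1 : ℕ) : ℝ) ^ k * ((2:ℝ) ^ (r + (j:ℕ)) * 5 ^ s) ^ l
          = ((2:ℝ) ^ r * 5 ^ s) ^ l * (((2:ℝ) ^ l) ^ (j:ℕ) * (Q l).eval (x0 + (j:ℕ) * b2)) := by
        intro l _
        rw [hQe, Finset.mul_sum, Finset.mul_sum]
        apply Finset.sum_congr rfl
        intro k _
        have : (((r + j) * b2 + s * b1 : ℕ) : ℝ) = x0 + (j:ℕ) * b2 := by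
          rw [hx0]; push_cast; ring
        rw [this]
        ring
      rw [Finset.sum_congr rfl h3] at hj
      have h4 : ∑ l ∈ supp, ((2:ℝ) ^ r * 5 ^ s) ^ l * (((2:ℝ) ^ l) ^ (j:ℕ) * (Q l).eval (x0 + (j:ℕ) * b2)) = 0 := by
        rw [← hj]
        apply Finset.sum_subset (Finset.filter_subset _ _)
        intro l hl hl2
        have : Q l = 0 := by
          by_contra h
          exact hl2 (Finset.mem_filter.2 ⟨hl, h⟩)
        simp [this]
      rw [← h4]
      have : supp = Finset.univ.map e.toEmbedding := by
        ext l
        simp only [Finset.mem_map, Finset.mem_univ, true_and]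
        have h5 := Finset.range_orderEmbOfFin supp hn
        constructor
        · intro h
          have : l ∈ Set.range e := by rw [h5]; exact h
          exact this
        · rintro ⟨i, rfl⟩
          exact hemem i
      rw [this, Finset.sum_map]
      rfl
  have hdet0 : M.det = 0 := by
    by_contra hd
    let pts : Finset ℝ := ((Finset.range R) ×ˢ (Finset.range S)).image
      (fun q : ℕ × ℕ => ((q.1 * b2 + q.2 * b1 : ℕ) : ℝ))
    have hcard : pts.card = R * S := by
      rw [Finset.card_image_of_injOn]
      · simp
      · rintro ⟨r, s⟩ h ⟨r', s'⟩ h' heq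
        simp only [Finset.coe_product, Finset.coe_range, Set.mem_prod, Set.mem_Iio] at h h'
        have heq' : r * b2 + s * b1 = r' * b2 + s' * b1 := Nat.cast_injective (R := ℝ) heq
        have hmod : s * b1 ≡ s' * b1 [MOD b2] := by
          have : (r * b2 + s * b1) % b2 = (r' * b2 + s' * b1) % b2 := by rw [heq']
          simpa [Nat.ModEq] using this
        have hmod2 : s ≡ s' [MOD b2] := Nat.ModEq.cancel_right_of_coprime
          (by rw [Nat.gcd_comm]; exact hco) hmod
        have hs : s = s' := by
          have := hmod2
          rwa [Nat.ModEq, Nat.mod_eq_of_lt (by omega), Nat.mod_eq_of_lt (by omega)] at this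
        subst hs
        have : r * b2 = r' * b2 := by omega
        have := Nat.eq_of_mul_eq_mul_right hb2 this
        simp [this]
    have hle : pts.card ≤ M.det.natDegree := by
      refine (Finset.card_le_card ?_).trans ((Multiset.toFinset_card_le _).trans
        (Polynomial.card_roots' M.det))
      intro x hx
      simp only [pts, Finset.mem_image, Finset.mem_product, Finset.mem_range] at hx
      obtain ⟨q, ⟨hq1, hq2⟩, rfl⟩ := hx
      simp only [Multiset.mem_toFinset, Polynomial.mem_roots', Polynomial.IsRoot]
      exact ⟨hd, hroot _ hq1 _ hq2⟩
    have h6 : n * (K - 1) < R * S := by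
      calc n * (K - 1) < n * K := by
            apply Nat.mul_lt_mul_of_pos_left <;> omega
        _ ≤ L * K := Nat.mul_le_mul_right _ hnL
        _ ≤ R * S := by rw [mul_comm]; exact hRS
    omega
  -- limit
  have hlim : Tendsto (fun x : ℝ => (Matrix.of (fun i j : Fin n =>
      ((2:ℝ) ^ (e i)) ^ (j:ℕ) * ((Q (e i)).eval (x + (j:ℕ) * b2) / (Q (e i)).eval x))).det) atTop
      (nhds (Matrix.vandermonde (fun i : Fin n => (2:ℝ) ^ (e i))).det) := by
    have hc : Continuous (fun A : Matrix (Fin n) (Fin n) ℝ => A.det) := by fun_prop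
    apply (hc.tendsto _).comp
    refine tendsto_pi_nhds.2 fun i => tendsto_pi_nhds.2 fun j => ?_
    have := (poly_ratio (Q (e i)) (hQne i) ((j:ℕ) * b2)).const_mul (((2:ℝ) ^ (e i)) ^ (j:ℕ))
    simpa [Matrix.vandermonde] using this
  have hne0 : (Matrix.vandermonde (fun i : Fin n => (2:ℝ) ^ (e i))).det ≠ 0 := by
    rw [Matrix.det_vandermonde_ne_zero_iff]
    intro i j hij
    have := pow_right_injective₀ (by norm_num : (0:ℝ) < 2) (by norm_num) hij
    exact e.injective this
  apply hne0
  refine tendsto_nhds_unique hlim ?_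
  have : (fun x : ℝ => (Matrix.of (fun i j : Fin n =>
      ((2:ℝ) ^ (e i)) ^ (j:ℕ) * ((Q (e i)).eval (x + (j:ℕ) * b2) / (Q (e i)).eval x))).det)
      = fun _ => 0 := by
    funext x
    have h1 : M.det.eval x = (M.map (Polynomial.eval x)).det := by
      have := RingHom.map_det (Polynomial.evalRingHom x) M
      simpa using this
    rw [hdet0] at h1
    have h2 := Matrix.det_mul_column (fun i : Fin n => ((Q (e i)).eval x)⁻¹) (M.map (Polynomial.eval x))
    rw [← h1] at h2
    simp only [Polynomial.eval_zero, mul_zero] at h2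
    rw [← h2]
    congr 1
    ext i j
    simp only [Matrix.of_apply, Matrix.map_apply, hMeval]
    ring
  rw [this]
  exact tendsto_const_nhds

lemma exp_tail (u : ℝ) (hu : 0 ≤ u) (D : ℕ) :
    |Real.exp u - ∑ d ∈ Finset.range D, u ^ d / (d.factorial : ℝ)| ≤ Real.exp (3 * u - D) := by
  have hs : Summable (fun d : ℕ => u ^ d / (d.factorial : ℝ)) := Real.summable_pow_div_factorial u
  have h1 : Real.exp u = ∑' d : ℕ, u ^ d / (d.factorial : ℝ) := by
    rw [Real.exp_eq_exp_ℝ, NormedSpace.exp_eq_tsum_div]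
  have h2 := hs.sum_add_tsum_nat_add D
  have h3 : Real.exp u - ∑ d ∈ Finset.range D, u ^ d / (d.factorial : ℝ)
      = ∑' d : ℕ, u ^ (d + D) / ((d + D).factorial : ℝ) := by
    rw [h1, ← h2]; ring
  rw [h3, abs_of_nonneg (tsum_nonneg fun d => by positivity)]
  have hs3 : Summable (fun d : ℕ => (3 * u) ^ d / (d.factorial : ℝ)) :=
    Real.summable_pow_div_factorial _
  set E := Real.exp (-(D:ℝ)) with hE
  have key : ∀ d : ℕ, u ^ (d + D) / ((d + D).factorial : ℝ) ≤
      E * ((3 * u) ^ (d + D) / ((d + D).factorial : ℝ)) := by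
    intro d
    have : 1 ≤ E * 3 ^ (d + D) := by
      have h4 : Real.exp D ≤ 3 ^ (d + D) := by
        calc Real.exp D = (Real.exp 1) ^ D := by rw [← Real.exp_nat_mul]; simp
          _ ≤ 3 ^ D := by
            gcongr
            have := Real.exp_one_lt_d9
            linarith
          _ ≤ 3 ^ (d + D) := by gcongr <;> [norm_num; omega]
      calc (1:ℝ) = E * Real.exp D := by rw [hE, ← Real.exp_add]; simp
        _ ≤ _ := by gcongr
    rw [mul_pow, mul_div_assoc, ← mul_assoc]
    have h5 : 0 ≤ u ^ (d + D) / ((d + D).factorial : ℝ) := by positivity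
    nlinarith
  have hs' : Summable (fun d : ℕ => u ^ (d + D) / ((d + D).factorial : ℝ)) :=
    (summable_nat_add_iff (f := fun d : ℕ => u ^ d / (d.factorial : ℝ)) D).2 hs
  have hs3' : Summable (fun d : ℕ => (3 * u) ^ (d + D) / ((d + D).factorial : ℝ)) :=
    (summable_nat_add_iff (f := fun d : ℕ => (3 * u) ^ d / (d.factorial : ℝ)) D).2 hs3
  calc _ ≤ ∑' d : ℕ, E * ((3 * u) ^ (d + D) / ((d + D).factorial : ℝ)) :=
        hs'.tsum_le_tsum key (hs3'.mul_left E)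
    _ = E * ∑' d : ℕ, ((3 * u) ^ (d + D) / ((d + D).factorial : ℝ)) := tsum_mul_left
    _ ≤ E * Real.exp (3 * u) := by
      gcongr
      have h6 : Real.exp (3 * u) = ∑' d : ℕ, (3 * u) ^ d / (d.factorial : ℝ) := by
        rw [Real.exp_eq_exp_ℝ, NormedSpace.exp_eq_tsum_div]
      rw [h6, ← hs3.sum_add_tsum_nat_add D]
      have : 0 ≤ ∑ d ∈ Finset.range D, (3 * u) ^ d / (d.factorial : ℝ) :=
        Finset.sum_nonneg fun d _ => by positivity
      linarith
    _ = _ := by rw [hE, ← Real.exp_add]; congr 1; ring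

lemma pigeon {ι : Type*} [Fintype ι] (M H : ℕ) (g : ℕ → ι → ℝ) (G δ : ℝ) (hδ : 0 < δ)
    (hg : ∀ m i, 0 ≤ g m i) (hG : ∀ m, ∑ i, g m i ≤ G) (hM : 1 ≤ M)
    (hMT : 2 * M ≤ Fintype.card ι) (hH : 1 ≤ H) (hGH : G ≤ H * δ) :
    ∃ p : ι → ℤ, p ≠ 0 ∧ (∀ i, |p i| ≤ H) ∧ ∀ m < M, |∑ i, g m i * p i| ≤ δ := by
  classical
  let s : Finset (ι → ℕ) := Fintype.piFinset (fun _ => Finset.range (H + 1))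
  let t : Finset (Fin M → ℕ) := Fintype.piFinset (fun _ => Finset.range (H ^ 2 + 1))
  let f : (ι → ℕ) → (Fin M → ℕ) := fun p m => ⌊(∑ i, g m i * p i) / δ⌋₊
  have hcard : t.card < s.card := by
    simp only [s, t, Fintype.card_piFinset, Finset.card_range, Finset.prod_const, Finset.card_univ,
      Fintype.card_fin]
    calc (H ^ 2 + 1) ^ M < ((H + 1) ^ 2) ^ M := by
          apply Nat.pow_lt_pow_left _ (by omega)
          nlinarith
      _ = (H + 1) ^ (2 * M) := by rw [← pow_mul]
      _ ≤ _ := Nat.pow_le_pow_right (by omega) hMT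
  have hmaps : ∀ p ∈ s, f p ∈ t := by
    intro p hp
    simp only [s, t, Fintype.mem_piFinset, Finset.mem_range, f] at hp ⊢
    intro m
    rw [Nat.lt_succ_iff]
    apply Nat.floor_le_of_le
    rw [div_le_iff₀ hδ]
    calc ∑ i, g m i * p i ≤ ∑ i, g m i * H := by
          apply Finset.sum_le_sum
          intro i _
          have : (p i : ℝ) ≤ H := by exact_mod_cast Nat.lt_succ_iff.1 (hp i)
          exact mul_le_mul_of_nonneg_left this (hg _ _)
      _ = (∑ i, g m i) * H := by rw [Finset.sum_mul]
      _ ≤ (H * δ) * H := by gcongr; exact (hG m).trans hGH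
      _ = _ := by push_cast; ring
  obtain ⟨p, hp, q, hq, hpq, hf⟩ := Finset.exists_ne_map_eq_of_card_lt_of_maps_to hcard hmaps
  simp only [s, Fintype.mem_piFinset, Finset.mem_range] at hp hq
  refine ⟨fun i => (p i : ℤ) - q i, ?_, ?_, ?_⟩
  · intro h
    apply hpq
    funext i
    have := congrFun h i
    simp only [Pi.zero_apply] at this
    omega
  · intro i
    have := hp i
    have := hq i
    simp only [abs_le]
    omega
  · intro m hm
    have h1 := congrFun hf ⟨m, hm⟩
    simp only [f] at h1
    have h0 : ∀ p : ι → ℕ, 0 ≤ (∑ i, g m i * p i) / δ := fun p =>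
      div_nonneg (Finset.sum_nonneg fun i _ => mul_nonneg (hg _ _) (Nat.cast_nonneg _)) hδ.le
    have a1 := Nat.floor_le (h0 p)
    have a2 := Nat.lt_floor_add_one ((∑ i, g m i * p i) / δ)
    have b1 := Nat.floor_le (h0 q)
    have b2 := Nat.lt_floor_add_one ((∑ i, g m i * q i) / δ)
    rw [h1] at a1 a2
    have h2 : ∑ i, g m i * (((p i : ℤ) - q i : ℤ) : ℝ) = ∑ i, g m i * p i - ∑ i, g m i * q i := by
      rw [← Finset.sum_sub_distrib]
      apply Finset.sum_congr rfl
      intro i _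
      push_cast
      ring
    rw [h2]
    have h3 : |(∑ i, g m i * p i) / δ - (∑ i, g m i * q i) / δ| ≤ 1 := by
      rw [abs_le]; constructor <;> linarith
    rw [← sub_div, abs_div, abs_of_pos hδ, div_le_iff₀ hδ, one_mul] at h3
    exact h3

lemma aux_poly (K L D H : ℕ) (c X U δ : ℝ) (hc : 0 ≤ c) (hX : 1 ≤ X) (hU : L * c * X ≤ U)
    (hδ : 0 < δ) (hK : 1 ≤ K) (hKD : 2 * (K + D) ≤ K * L) (hH : 1 ≤ H)
    (hHb : K * L * X ^ K * Real.exp U ≤ H * δ) :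
    ∃ p : ℕ → ℕ → ℤ, (∃ k < K, ∃ l < L, p k l ≠ 0) ∧ (∀ k l, |p k l| ≤ H) ∧
      ∀ x : ℝ, 0 ≤ x → x ≤ X →
        |∑ k ∈ Finset.range K, ∑ l ∈ Finset.range L, (p k l : ℝ) * x ^ k * Real.exp (l * c * x)|
          ≤ (K + D) * δ + K * L * H * X ^ K * Real.exp (3 * U - D) := by
  classical
  have hX0 : 0 < X := by linarith
  let g : ℕ → (Fin K × Fin L) → ℝ := fun m i =>
    ∑ d ∈ Finset.range D, if (i.1 : ℕ) + d = m then X ^ (i.1 : ℕ) * ((i.2 : ℕ) * c * X) ^ d / (d.factorial : ℝ) else 0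
  have hlU : ∀ l : Fin L, ((l : ℕ) : ℝ) * c * X ≤ U := by
    intro l
    refine le_trans ?_ hU
    have : ((l : ℕ) : ℝ) ≤ L := by exact_mod_cast l.2.le
    gcongr
  have hg : ∀ m i, 0 ≤ g m i := by
    intro m i
    apply Finset.sum_nonneg
    intro d _
    split_ifs
    · positivity
    · exact le_rfl
  have hgle : ∀ m i, g m i ≤ X ^ K * Real.exp U := by
    intro m i
    calc g m i ≤ ∑ d ∈ Finset.range D, X ^ (i.1 : ℕ) * (((i.2 : ℕ) * c * X) ^ d / (d.factorial : ℝ)) := by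
          apply Finset.sum_le_sum
          intro d _
          split_ifs
          · rw [mul_div_assoc]
          · positivity
      _ = X ^ (i.1 : ℕ) * ∑ d ∈ Finset.range D, (((i.2 : ℕ) * c * X) ^ d / (d.factorial : ℝ)) := by
          rw [Finset.mul_sum]
      _ ≤ X ^ K * Real.exp U := by
          gcongr
          · exact i.1.2.le
          · exact (Real.sum_le_exp_of_nonneg (by positivity) D).trans (Real.exp_le_exp.2 (hlU _))
  obtain ⟨p, hp0, hpH, hpm⟩ := pigeon (K + D) H g (K * L * X ^ K * Real.exp U) δ hδ hg
    (by
      intro m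
      calc ∑ i, g m i ≤ ∑ i : Fin K × Fin L, X ^ K * Real.exp U := Finset.sum_le_sum fun i _ => hgle m i
        _ = _ := by simp; ring) (by omega) (by simpa using hKD) hH hHb
  refine ⟨fun k l => if h : k < K ∧ l < L then p (⟨k, h.1⟩, ⟨l, h.2⟩) else 0, ?_, ?_, ?_⟩
  · obtain ⟨i, hi⟩ := Function.ne_iff.1 hp0
    refine ⟨i.1, i.1.2, i.2, i.2.2, ?_⟩
    simpa using hi
  · intro k l
    dsimp only
    split_ifs with h
    · exact hpH _
    · simp
  · intro x hx0 hxX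
    have e1 : ∑ k ∈ Finset.range K, ∑ l ∈ Finset.range L, (((if h : k < K ∧ l < L then p (⟨k, h.1⟩, ⟨l, h.2⟩) else 0 : ℤ)) : ℝ) * x ^ k * Real.exp (l * c * x)
        = ∑ i : Fin K × Fin L, (p i : ℝ) * x ^ (i.1 : ℕ) * Real.exp ((i.2 : ℕ) * c * x) := by
      rw [Fintype.sum_prod_type, Finset.sum_range]
      apply Finset.sum_congr rfl
      intro k _
      rw [Finset.sum_range]
      apply Finset.sum_congr rfl
      intro l _
      simp
    rw [e1]
    have e2 : ∀ i : Fin K × Fin L, ∑ m ∈ Finset.range (K + D), (x / X) ^ m * g m i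
        = x ^ (i.1 : ℕ) * ∑ d ∈ Finset.range D, ((i.2 : ℕ) * c * x) ^ d / (d.factorial : ℝ) := by
      intro i
      simp only [g, Finset.mul_sum]
      rw [Finset.sum_comm]
      apply Finset.sum_congr rfl
      intro d hd
      have hlt : (i.1 : ℕ) + d ∈ Finset.range (K + D) := by
        have := i.1.2
        have := Finset.mem_range.1 hd
        simp only [Finset.mem_range]; omega
      simp only [mul_ite, mul_zero]
      rw [Finset.sum_ite_eq, if_pos hlt, div_pow, pow_add, pow_add, mul_pow, mul_pow, mul_pow, mul_pow]
      field_simp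
    have e3 : ∑ i : Fin K × Fin L, (p i : ℝ) * x ^ (i.1 : ℕ) * Real.exp ((i.2 : ℕ) * c * x)
        = ∑ m ∈ Finset.range (K + D), (x / X) ^ m * (∑ i, g m i * p i)
          + ∑ i : Fin K × Fin L, (p i : ℝ) * x ^ (i.1 : ℕ) * (Real.exp ((i.2 : ℕ) * c * x)
            - ∑ d ∈ Finset.range D, ((i.2 : ℕ) * c * x) ^ d / (d.factorial : ℝ)) := by
      have : ∑ m ∈ Finset.range (K + D), (x / X) ^ m * (∑ i, g m i * p i)
          = ∑ i, (p i : ℝ) * ∑ m ∈ Finset.range (K + D), (x / X) ^ m * g m i := by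
        simp only [Finset.mul_sum]
        rw [Finset.sum_comm]
        apply Finset.sum_congr rfl
        intro i _
        apply Finset.sum_congr rfl
        intro m _
        ring
      rw [this, ← Finset.sum_add_distrib]
      apply Finset.sum_congr rfl
      intro i _
      rw [e2]
      ring
    rw [e3]
    refine (abs_add_le _ _).trans (add_le_add ?_ ?_)
    · refine (Finset.abs_sum_le_sum_abs _ _).trans ?_
      calc _ ≤ ∑ m ∈ Finset.range (K + D), δ := by
            apply Finset.sum_le_sum
            intro m hm
            rw [abs_mul, abs_of_nonneg (by positivity)]
            have h1 : (x / X) ^ m ≤ 1 := pow_le_one₀ (by positivity) ((div_le_one hX0).2 hxX)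
            have h2 := hpm m (Finset.mem_range.1 hm)
            calc _ ≤ 1 * δ := by gcongr
              _ = δ := one_mul _
        _ = _ := by simp
    · refine (Finset.abs_sum_le_sum_abs _ _).trans ?_
      calc _ ≤ ∑ i : Fin K × Fin L, (H : ℝ) * X ^ K * Real.exp (3 * U - D) := by
            apply Finset.sum_le_sum
            intro i _
            rw [abs_mul, abs_mul, abs_of_nonneg (a := x ^ _) (by positivity)]
            have h1 : |(p i : ℝ)| ≤ H := by exact_mod_cast hpH i
            have h2 : x ^ (i.1 : ℕ) ≤ X ^ K :=
              (pow_le_pow_left₀ hx0 hxX _).trans (pow_le_pow_right₀ hX i.1.2.le)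
            have h3 := exp_tail ((i.2 : ℕ) * c * x) (by positivity) D
            have h4 : ((i.2 : ℕ) : ℝ) * c * x ≤ U := by
              refine le_trans ?_ (hlU i.2)
              gcongr
            have h5 : Real.exp (3 * ((i.2 : ℕ) * c * x) - D) ≤ Real.exp (3 * U - D) :=
              Real.exp_le_exp.2 (by linarith)
            gcongr
            exact h3.trans h5
        _ = _ := by simp; ring

set_option maxHeartbeats 4000000 in
lemma gel (n b1 b2 : ℕ) (hn : 1000 ≤ n) (hco : Nat.Coprime b1 b2) (hb2 : n ^ 3 ≤ b2)
    (hb1 : b1 ≤ 3 * b2) (hb : 8 * (n:ℝ) ^ 3 * b2 ≤ Real.exp (n / 16)) :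
    Real.exp (-(n:ℝ) ^ 5) < |b1 * Real.log 2 - b2 * Real.log 5| := by
  by_contra hcon
  push Not at hcon
  set Λ : ℝ := b1 * Real.log 2 - b2 * Real.log 5 with hΛ
  have hn' : (1000:ℝ) ≤ n := by exact_mod_cast hn
  have hb2pos : 0 < b2 := lt_of_lt_of_le (by positivity) hb2
  have hb2' : (1:ℝ) ≤ b2 := by exact_mod_cast hb2pos
  obtain ⟨v, hv⟩ : ∃ v : ℝ, v = (n:ℝ) ^ 5 := ⟨_, rfl⟩
  have hn4 : 1000 * (n:ℝ) ^ 4 ≤ v := by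
    rw [hv]
    have : 0 ≤ (n:ℝ) ^ 4 := by positivity
    nlinarith
  have hv4 : (10:ℝ) ^ 15 ≤ v := by
    rw [hv]
    calc (10:ℝ) ^ 15 = 1000 ^ 5 := by norm_num
      _ ≤ _ := by gcongr
  have hn3 : (1:ℝ) ≤ (n:ℝ) ^ 3 := one_le_pow₀ (by linarith)
  have hn41 : (1:ℝ) ≤ (n:ℝ) ^ 4 := one_le_pow₀ (by linarith)
  have hcube : ∀ x : ℝ, 0 ≤ x → x ^ 3 / 6 ≤ Real.exp x := by
    intro x hx
    have := Real.pow_div_factorial_le_exp x hx 3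
    simpa [Nat.factorial] using this
  have hexp : 10000 * v ^ 2 ≤ Real.exp (v / 16) := by
    refine le_trans ?_ (hcube (v / 16) (by linarith))
    have : 0 ≤ v ^ 2 := by positivity
    nlinarith
  set X : ℝ := 8 * (n:ℝ) ^ 3 * b2 with hX
  set c : ℝ := Real.log 2 / b2 with hc
  have hlog2 : 0 < Real.log 2 := Real.log_pos (by norm_num)
  have hlog2' : Real.log 2 ≤ 1 := by linarith [Real.log_two_lt_d9]
  have hc0 : 0 ≤ c := by positivity
  have hX1 : 1 ≤ X := by rw [hX]; nlinarith
  set U : ℝ := 32 * (n:ℝ) ^ 4 with hU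
  have hLU : ((4 * n : ℕ) : ℝ) * c * X ≤ U := by
    have : ((4 * n : ℕ) : ℝ) * c * X = 32 * (n:ℝ) ^ 4 * Real.log 2 := by
      rw [hc, hX]; push_cast; field_simp; ring
    rw [this, hU]
    nlinarith
  have hXK : X ^ (n ^ 4) ≤ Real.exp (v / 16) := by
    calc X ^ (n ^ 4) ≤ (Real.exp (n / 16)) ^ (n ^ 4) := by gcongr
      _ = Real.exp (v / 16) := by
        rw [← Real.exp_nat_mul, hv]; congr 1; push_cast; ring
  have hUe : Real.exp U ≤ Real.exp (v / 16) := Real.exp_le_exp.2 (by rw [hU]; linarith)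
  obtain ⟨H, hH⟩ : ∃ H : ℕ, H = ⌈32 * v ^ 2 * Real.exp (v / 16) * Real.exp (v / 16)⌉₊ := ⟨_, rfl⟩
  have he1 : 1 ≤ Real.exp (v / 16) := Real.one_le_exp (by linarith)
  have hHge : 32 * v ^ 2 * Real.exp (v / 16) * Real.exp (v / 16) ≤ H := by
    rw [hH]; exact Nat.le_ceil _
  set e := Real.exp (v / 16) with he
  have hee : 1 ≤ e * e := by nlinarith
  have hHle : (H:ℝ) ≤ e ^ 3 := by
    have h1 : (H:ℝ) < 32 * v ^ 2 * e * e + 1 := by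
      rw [hH]; exact Nat.ceil_lt_add_one (by positivity)
    have h2 : 1 ≤ v ^ 2 * (e * e) := by
      have : 1 ≤ v ^ 2 := by nlinarith
      nlinarith
    have h3 : 33 * v ^ 2 * (e * e) ≤ e * (e * e) := by
      apply mul_le_mul_of_nonneg_right _ (by linarith)
      nlinarith [sq_nonneg v]
    nlinarith
  have hH1 : 1 ≤ H := by
    rw [hH]; apply Nat.one_le_ceil_iff.2; positivity
  set δ : ℝ := 1 / (4 * (n ^ 4 + n ^ 5 : ℝ)) with hδ
  have hsum : 0 < (n ^ 4 + n ^ 5 : ℝ) := by positivity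
  have hδ0 : 0 < δ := by positivity
  have hδge : 1 / (8 * v) ≤ δ := by
    rw [hδ]
    apply one_div_le_one_div_of_le (by positivity)
    rw [← hv]; linarith
  obtain ⟨p, hp0, hpH, hpx⟩ := aux_poly (n ^ 4) (4 * n) (n ^ 5) H c X U δ hc0 hX1 hLU hδ0
    (Nat.one_le_pow _ _ (by omega))
    (by
      have : n ^ 4 ≤ n ^ 5 := Nat.pow_le_pow_right (by omega) (by norm_num)
      have h2 : n ^ 4 * (4 * n) = 4 * n ^ 5 := by ring
      omega) hH1
    (by
      calc ((n ^ 4 : ℕ) : ℝ) * ((4 * n : ℕ) : ℝ) * X ^ (n ^ 4) * Real.exp U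
          = 4 * v * X ^ (n ^ 4) * Real.exp U := by rw [hv]; push_cast; ring
        _ ≤ 4 * v * e * e := by gcongr
        _ = (32 * v ^ 2 * e * e) * (1 / (8 * v)) := by field_simp; norm_num
        _ ≤ H * δ := by gcongr)
  have hv0 : 0 < v := by linarith
  have hT : ((n ^ 4 : ℕ) : ℝ) * ((4 * n : ℕ) : ℝ) = 4 * v := by rw [hv]; push_cast; ring
  have hXK0 : 0 ≤ X ^ (n ^ 4) := by positivity
  have hexpv : Real.exp (-v) = 1 / e ^ 16 := by
    rw [he, ← Real.exp_nat_mul, Real.exp_neg]; rw [one_div]; congr 2; push_cast; ring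
  have he0 : 0 < e := by linarith
  have hve : 10000 * v ≤ e := by
    have : v ≤ v ^ 2 := by nlinarith
    linarith
  have hmain : ((n ^ 4 : ℕ) + (n ^ 5 : ℕ) : ℝ) * δ + ((n ^ 4 : ℕ) : ℝ) * ((4 * n : ℕ) : ℝ) * H * X ^ (n ^ 4) *
      Real.exp (3 * U - (n ^ 5 : ℕ)) ≤ 1 / 2 := by
    have h1 : ((n ^ 4 : ℕ) + (n ^ 5 : ℕ) : ℝ) * δ = 1 / 4 := by
      rw [hδ]; push_cast; field_simp
    have h2 : Real.exp (3 * U - (n ^ 5 : ℕ)) ≤ e ^ 2 * (1 / e ^ 16) := by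
      rw [← hexpv, he, ← Real.exp_nat_mul, ← Real.exp_add]
      apply Real.exp_le_exp.2
      have : ((n ^ 5 : ℕ) : ℝ) = v := by rw [hv]; push_cast; rfl
      rw [this, hU]; push_cast; linarith
    rw [h1, hT]
    have h3 : 4 * v * H * X ^ (n ^ 4) * Real.exp (3 * U - (n ^ 5 : ℕ)) ≤ 4 * v * e ^ 3 * e * (e ^ 2 * (1 / e ^ 16)) := by
      gcongr
    have h4 : 4 * v * e ^ 3 * e * (e ^ 2 * (1 / e ^ 16)) = 4 * v / e ^ 10 := by field_simp
    have h5 : 4 * v / e ^ 10 ≤ 1 / 4 := by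
      rw [div_le_iff₀ (by positivity)]
      have : e ≤ e ^ 10 := le_self_pow₀ he1 (by norm_num)
      linarith
    linarith
  refine zero_est (n ^ 4) (4 * n) (n ^ 3) (n ^ 3) b1 b2 p hp0 hco hb2 hb2pos ?_ ?_
  · calc n ^ 4 * (4 * n) = 4 * n ^ 5 := by ring
      _ ≤ n * n ^ 5 := Nat.mul_le_mul_right _ (by omega)
      _ = n ^ 3 * n ^ 3 := by ring
  intro r hr s hs
  have h4n : 4 * n ≤ n ^ 3 := by nlinarith [Nat.mul_le_mul hn hn]
  have hr2 : r ≤ 2 * n ^ 3 := by omega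
  have hr' : (r:ℝ) ≤ 2 * (n:ℝ) ^ 3 := by exact_mod_cast hr2
  have hs' : (s:ℝ) ≤ (n:ℝ) ^ 3 := by exact_mod_cast hs.le
  have hb1' : (b1:ℝ) ≤ 3 * b2 := by exact_mod_cast hb1
  set ξ : ℝ := ((r * b2 + s * b1 : ℕ) : ℝ) with hξ
  have hξ0 : 0 ≤ ξ := Nat.cast_nonneg _
  have hξX : ξ ≤ X := by
    rw [hξ, hX]; push_cast
    have h1 : (r:ℝ) * b2 ≤ 2 * (n:ℝ) ^ 3 * b2 := by gcongr
    have h2 : (s:ℝ) * b1 ≤ (n:ℝ) ^ 3 * (3 * b2) := by gcongr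
    nlinarith
  have hF := (hpx ξ hξ0 hξX).trans hmain
  have hterm : ∀ l : ℕ, ((2:ℝ) ^ r * 5 ^ s) ^ l = Real.exp (l * c * ξ) * Real.exp (-(l * s * Λ / b2)) := by
    intro l
    have h2 : (2:ℝ) ^ r = Real.exp (r * Real.log 2) := by
      rw [Real.exp_nat_mul, Real.exp_log (by norm_num)]
    have h5 : (5:ℝ) ^ s = Real.exp (s * Real.log 5) := by
      rw [Real.exp_nat_mul, Real.exp_log (by norm_num)]
    rw [h2, h5, ← Real.exp_add, ← Real.exp_nat_mul, ← Real.exp_add]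
    congr 1
    rw [hc, hξ, hΛ]; push_cast; field_simp; ring
  have hdiff : |∑ k ∈ Finset.range (n ^ 4), ∑ l ∈ Finset.range (4 * n),
      (p k l : ℝ) * ξ ^ k * ((2:ℝ) ^ r * 5 ^ s) ^ l -
      ∑ k ∈ Finset.range (n ^ 4), ∑ l ∈ Finset.range (4 * n), (p k l : ℝ) * ξ ^ k * Real.exp (l * c * ξ)|
      ≤ 1 / 4 := by
    rw [← Finset.sum_sub_distrib]
    simp_rw [← Finset.sum_sub_distrib]
    have hΛ' : |Λ| ≤ 1 / e ^ 16 := by rw [← hexpv, hv]; exact hcon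
    have hb : ∀ k ∈ Finset.range (n ^ 4), ∀ l ∈ Finset.range (4 * n),
        |(p k l : ℝ) * ξ ^ k * ((2:ℝ) ^ r * 5 ^ s) ^ l - (p k l : ℝ) * ξ ^ k * Real.exp (l * c * ξ)|
        ≤ e ^ 3 * e * e * (2 * (4 * (n:ℝ) ^ 4 * (1 / e ^ 16))) := by
      intro k hk l hl
      have hk' := (Finset.mem_range.1 hk).le
      have hl' : (l:ℝ) ≤ 4 * n := by exact_mod_cast (Finset.mem_range.1 hl).le
      rw [hterm, show (p k l : ℝ) * ξ ^ k * (Real.exp (l * c * ξ) * Real.exp (-(l * s * Λ / b2))) -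
        (p k l : ℝ) * ξ ^ k * Real.exp (l * c * ξ) = (p k l : ℝ) * ξ ^ k * Real.exp (l * c * ξ) *
          (Real.exp (-(l * s * Λ / b2)) - 1) by ring, abs_mul, abs_mul, abs_mul,
          abs_of_nonneg (a := ξ ^ k) (by positivity), abs_of_pos (Real.exp_pos _)]
      have h1 : |(p k l : ℝ)| ≤ e ^ 3 := le_trans (by exact_mod_cast hpH k l) hHle
      have h2 : ξ ^ k ≤ e := le_trans ((pow_le_pow_left₀ hξ0 hξX _).trans (pow_le_pow_right₀ hX1 hk')) hXK
      have h3 : Real.exp (l * c * ξ) ≤ e := by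
        refine le_trans (Real.exp_le_exp.2 ?_) hUe
        refine le_trans ?_ hLU
        push_cast
        gcongr
      have hz : |-(l * s * Λ / b2)| ≤ 4 * (n:ℝ) ^ 4 * (1 / e ^ 16) := by
        rw [abs_neg, abs_div, abs_mul, abs_mul, Nat.abs_cast, Nat.abs_cast, Nat.abs_cast]
        calc (l:ℝ) * s * |Λ| / b2 ≤ l * s * |Λ| := div_le_self (by positivity) hb2'
          _ ≤ (4 * n) * (n:ℝ) ^ 3 * (1 / e ^ 16) := by gcongr
          _ = _ := by ring
      have hz1 : 4 * (n:ℝ) ^ 4 * (1 / e ^ 16) ≤ 1 := by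
        rw [mul_one_div, div_le_one (by positivity)]
        have : e ≤ e ^ 16 := le_self_pow₀ he1 (by norm_num)
        linarith
      have h4 := Real.abs_exp_sub_one_le (hz.trans hz1)
      gcongr
      linarith
    calc _ ≤ ∑ k ∈ Finset.range (n ^ 4), ∑ l ∈ Finset.range (4 * n),
          e ^ 3 * e * e * (2 * (4 * (n:ℝ) ^ 4 * (1 / e ^ 16))) := by
          refine (Finset.abs_sum_le_sum_abs _ _).trans (Finset.sum_le_sum fun k hk => ?_)
          exact (Finset.abs_sum_le_sum_abs _ _).trans (Finset.sum_le_sum fun l hl => hb k hk l hl)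
      _ = (((n ^ 4 : ℕ) : ℝ) * ((4 * n : ℕ) : ℝ)) * (8 * (n:ℝ) ^ 4) / e ^ 11 := by
          simp only [Finset.sum_const, Finset.card_range, nsmul_eq_mul]
          field_simp
          ring
      _ ≤ (4 * v) * (8 * v) / e ^ 11 := by
          rw [hT]
          gcongr
          linarith
      _ ≤ 1 / 4 := by
          rw [div_le_iff₀ (by positivity)]
          have : e ≤ e ^ 11 := le_self_pow₀ he1 (by norm_num)
          have h2 : 4 * v * (8 * v) = 32 * v ^ 2 := by ring
          rw [h2]
          linarith [sq_nonneg v]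
  have hint : ∑ k ∈ Finset.range (n ^ 4), ∑ l ∈ Finset.range (4 * n),
      (p k l : ℝ) * ξ ^ k * ((2:ℝ) ^ r * 5 ^ s) ^ l =
      ((∑ k ∈ Finset.range (n ^ 4), ∑ l ∈ Finset.range (4 * n),
      p k l * ((r * b2 + s * b1 : ℕ) : ℤ) ^ k * ((2:ℤ) ^ r * 5 ^ s) ^ l : ℤ) : ℝ) := by
    rw [hξ]; push_cast; rfl
  rw [hint] at hdiff ⊢
  have habs := abs_le.1 hdiff
  have hF' := abs_le.1 hF
  have hlt : |((∑ k ∈ Finset.range (n ^ 4), ∑ l ∈ Finset.range (4 * n),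
      p k l * ((r * b2 + s * b1 : ℕ) : ℤ) ^ k * ((2:ℤ) ^ r * 5 ^ s) ^ l : ℤ) : ℝ)| < 1 := by
    rw [abs_lt]; constructor <;> linarith [habs.1, habs.2, hF'.1, hF'.2]
  have : |(∑ k ∈ Finset.range (n ^ 4), ∑ l ∈ Finset.range (4 * n),
      p k l * ((r * b2 + s * b1 : ℕ) : ℤ) ^ k * ((2:ℤ) ^ r * 5 ^ s) ^ l : ℤ)| < 1 := by
    exact_mod_cast hlt
  rw [Int.abs_lt_one_iff.1 this]
  simp

lemma log_nat_diff (x y : ℕ) (hx : 0 < x) (hxy : y < x) (hy : 0 < y) :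
    1 / (x:ℝ) ≤ Real.log x - Real.log y := by
  have hx' : (0:ℝ) < x := by exact_mod_cast hx
  have hy' : (0:ℝ) < y := by exact_mod_cast hy
  have h1 := Real.log_le_sub_one_of_pos (div_pos hy' hx')
  rw [Real.log_div hy'.ne' hx'.ne'] at h1
  have h2 : (y:ℝ) + 1 ≤ x := by exact_mod_cast hxy
  have h3 : (y:ℝ) / x ≤ 1 - 1 / x := by
    rw [div_le_iff₀ hx', sub_mul, one_mul, div_mul_cancel₀ _ hx'.ne']; linarith
  linarith

lemma gel_any (n b1 b2 : ℕ) (hn : 1000 ≤ n) (h1 : 0 < b1) (h2 : 0 < b2)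
    (hb : 8 * (n:ℝ) ^ 3 * b2 ≤ Real.exp (n / 16)) :
    Real.exp (-(n:ℝ) ^ 5) ≤ |b1 * Real.log 2 - b2 * Real.log 5| := by
  have hn' : (1000:ℝ) ≤ n := by exact_mod_cast hn
  have hexp1 : Real.exp (-(n:ℝ) ^ 5) ≤ 1 / 3 := by
    have h3 : (3:ℝ) ≤ Real.exp ((n:ℝ) ^ 5) := by
      have h4 := Real.add_one_le_exp ((n:ℝ) ^ 5)
      have : (n:ℝ) ≤ (n:ℝ) ^ 5 := le_self_pow₀ (by linarith) (by norm_num)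
      linarith
    rw [Real.exp_neg, ← one_div]
    exact one_div_le_one_div_of_le (by norm_num) h3
  -- coprime case
  have cop : ∀ c1 c2 : ℕ, 0 < c1 → 0 < c2 → Nat.Coprime c1 c2 → c2 ≤ b2 →
      Real.exp (-(n:ℝ) ^ 5) ≤ |c1 * Real.log 2 - c2 * Real.log 5| := by
    intro c1 c2 hc1 hc2 hco hle
    by_cases h3 : c1 ≤ 3 * c2
    · by_cases h4 : n ^ 3 ≤ c2
      · refine (gel n c1 c2 hn hco h4 h3 ?_).le
        refine le_trans ?_ hb
        have : (c2:ℝ) ≤ b2 := by exact_mod_cast hle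
        gcongr
      · push Not at h4
        have hne : 2 ^ c1 ≠ 5 ^ c2 := by
          intro h
          have h5 : 2 ∣ 5 ^ c2 := h ▸ dvd_pow_self 2 hc1.ne'
          have := Nat.Prime.dvd_of_dvd_pow Nat.prime_two h5
          omega
        have hl1 : (c1:ℝ) * Real.log 2 = Real.log ((2 ^ c1 : ℕ) : ℝ) := by
          push_cast; rw [Real.log_pow]
        have hl2 : (c2:ℝ) * Real.log 5 = Real.log ((5 ^ c2 : ℕ) : ℝ) := by
          push_cast; rw [Real.log_pow]
        rw [hl1, hl2]
        have hbound : ∀ x : ℕ, 0 < x → x ≤ 8 ^ (n ^ 3) → Real.exp (-(n:ℝ) ^ 5) ≤ 1 / (x:ℝ) := by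
          intro x hx hx8
          have h6 : (x:ℝ) ≤ Real.exp ((n:ℝ) ^ 5) := by
            calc (x:ℝ) ≤ ((8 ^ (n ^ 3) : ℕ) : ℝ) := by exact_mod_cast hx8
              _ = (8:ℝ) ^ (n ^ 3) := by push_cast; rfl
              _ ≤ (Real.exp 7) ^ (n ^ 3) := by
                gcongr
                have := Real.add_one_le_exp (7:ℝ)
                linarith
              _ = Real.exp (n ^ 3 * 7) := by rw [← Real.exp_nat_mul]; push_cast; rfl
              _ ≤ _ := by
                apply Real.exp_le_exp.2
                have : (n:ℝ) ^ 5 = n ^ 3 * (n * n) := by ring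
                rw [this]
                gcongr
                nlinarith
          rw [Real.exp_neg, ← one_div]
          exact one_div_le_one_div_of_le (by exact_mod_cast hx) h6
        have hx1 : 2 ^ c1 ≤ 8 ^ (n ^ 3) := by
          calc 2 ^ c1 ≤ 2 ^ (3 * n ^ 3) := Nat.pow_le_pow_right (by norm_num) (by omega)
            _ = _ := by rw [pow_mul]; norm_num
        have hx2 : 5 ^ c2 ≤ 8 ^ (n ^ 3) := by
          calc 5 ^ c2 ≤ 8 ^ c2 := Nat.pow_le_pow_left (by norm_num) _
            _ ≤ _ := Nat.pow_le_pow_right (by norm_num) h4.le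
        rcases lt_or_gt_of_ne hne with h | h
        · have := log_nat_diff _ _ (by positivity) h (by positivity)
          rw [abs_sub_comm]
          exact ((hbound _ (by positivity) hx2).trans this).trans (le_abs_self _)
        · have := log_nat_diff _ _ (by positivity) h (by positivity)
          exact ((hbound _ (by positivity) hx1).trans this).trans (le_abs_self _)
    · push Not at h3
      have h3' : 3 * (c2:ℝ) + 1 ≤ c1 := by exact_mod_cast h3
      have hc2' : (1:ℝ) ≤ c2 := by exact_mod_cast hc2
      have h8 : Real.log 5 ≤ 3 * Real.log 2 := by
        have : 3 * Real.log 2 = Real.log 8 := by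
          rw [show (8:ℝ) = 2 ^ 3 by norm_num, Real.log_pow]; norm_num
        rw [this]
        exact Real.log_le_log (by norm_num) (by norm_num)
      have h9 := Real.log_two_gt_d9
      refine le_trans ?_ (le_abs_self _)
      nlinarith
  set g := Nat.gcd b1 b2 with hg
  have hg0 : 0 < g := Nat.gcd_pos_of_pos_left _ h1
  obtain ⟨c1, hc1⟩ : g ∣ b1 := Nat.gcd_dvd_left _ _
  obtain ⟨c2, hc2⟩ : g ∣ b2 := Nat.gcd_dvd_right _ _
  have hco : Nat.Coprime c1 c2 := by
    have := Nat.coprime_div_gcd_div_gcd hg0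
    rw [← hg] at this
    rwa [hc1, hc2, Nat.mul_div_cancel_left _ hg0, Nat.mul_div_cancel_left _ hg0] at this
  have hc1p : 0 < c1 := by
    rcases Nat.eq_zero_or_pos c1 with h | h
    · rw [h] at hc1; omega
    · exact h
  have hc2p : 0 < c2 := by
    rcases Nat.eq_zero_or_pos c2 with h | h
    · rw [h] at hc2; omega
    · exact h
  have hle : c2 ≤ b2 := by rw [hc2]; exact Nat.le_mul_of_pos_left _ hg0
  refine (cop c1 c2 hc1p hc2p hco hle).trans ?_
  have e1 : (b1:ℝ) * Real.log 2 - b2 * Real.log 5 = g * (c1 * Real.log 2 - c2 * Real.log 5) := by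
    have a1 : (b1:ℝ) = g * c1 := by exact_mod_cast hc1
    have a2 : (b2:ℝ) = g * c2 := by exact_mod_cast hc2
    rw [a1, a2]; ring
  rw [e1, abs_mul, Nat.abs_cast]
  apply le_mul_of_one_le_left (abs_nonneg _)
  exact_mod_cast hg0

theorem dioph (A : ℕ) : ∃ Y0 : ℕ, ∀ Y ≥ Y0, ∀ t : ℕ, 1 ≤ t → t ≤ Y ^ A → ∀ a : ℤ,
    Real.exp (-(Y:ℝ)) ≤ |t * Real.logb 10 2 - a| := by
  have hev : ∀ᶠ n : ℕ in atTop, 8 * (n:ℝ) ^ 3 * ((n:ℝ) + 1) ^ (6 * A) ≤ Real.exp (n / 16) := by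
    have h1 : Tendsto (fun x : ℝ => x ^ (6 * A + 4) / Real.exp (x / 16)) atTop (nhds 0) := by
      have := (Real.tendsto_pow_mul_exp_neg_atTop_nhds_zero (6 * A + 4)).comp
        (tendsto_id.atTop_div_const (by norm_num : (0:ℝ) < 16))
      have h2 := this.const_mul ((16:ℝ) ^ (6 * A + 4))
      simp only [mul_zero] at h2
      refine h2.congr fun x => ?_
      simp only [Function.comp, id, Real.exp_neg, div_pow]
      field_simp
    have h2 := (h1.comp tendsto_natCast_atTop_atTop).eventually (gt_mem_nhds
      (by positivity : (0:ℝ) < 1 / (8 * 2 ^ (6 * A))))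
    filter_upwards [h2, eventually_ge_atTop 1] with n hn hn1
    simp only [Function.comp] at hn
    have hn1' : (1:ℝ) ≤ n := by exact_mod_cast hn1
    rw [div_lt_div_iff₀ (Real.exp_pos _) (by positivity)] at hn
    calc 8 * (n:ℝ) ^ 3 * ((n:ℝ) + 1) ^ (6 * A) ≤ 8 * (n:ℝ) ^ 4 * (2 * n) ^ (6 * A) := by
          gcongr
          · norm_num
          · linarith
      _ = (n:ℝ) ^ (6 * A + 4) * (8 * 2 ^ (6 * A)) := by rw [mul_pow, pow_add]; ring
      _ ≤ _ := by linarith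
  obtain ⟨n0, hn0⟩ := eventually_atTop.1 hev
  refine ⟨(max n0 1000) ^ 6, fun Y hY t ht htY a => ?_⟩
  obtain ⟨n, hn1, hn2⟩ : ∃ n : ℕ, n ^ 6 ≤ Y ∧ Y < (n + 1) ^ 6 := by
    have hex : ∃ m : ℕ, Y < (m + 1) ^ 6 := ⟨Y, lt_of_lt_of_le (Nat.lt_succ_self Y) (Nat.le_self_pow (by norm_num) _)⟩
    classical
    refine ⟨Nat.find hex, ?_, Nat.find_spec hex⟩
    rcases Nat.eq_zero_or_pos (Nat.find hex) with h | h
    · rw [h]; simp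
    · have := Nat.find_min hex (Nat.sub_lt h one_pos)
      rw [show Nat.find hex - 1 + 1 = Nat.find hex from Nat.sub_add_cancel h] at this
      omega
  have hnn : max n0 1000 ≤ n := by
    by_contra h
    push Not at h
    have : (n + 1) ^ 6 ≤ (max n0 1000) ^ 6 := Nat.pow_le_pow_left h _
    omega
  have hnn0 : n0 ≤ n := le_trans (le_max_left _ _) hnn
  have hn1000 : 1000 ≤ n := le_trans (le_max_right _ _) hnn
  have hn' : (1000:ℝ) ≤ n := by exact_mod_cast hn1000
  have hlog10 : Real.log 10 = Real.log 2 + Real.log 5 := by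
    rw [← Real.log_mul (by norm_num) (by norm_num)]; norm_num
  have hl2 := Real.log_two_gt_d9
  have hl2' := Real.log_two_lt_d9
  have hl5 : Real.log 2 ≤ Real.log 5 := Real.log_le_log (by norm_num) (by norm_num)
  have hl5' : Real.log 5 ≤ 3 * Real.log 2 := by
    have : 3 * Real.log 2 = Real.log 8 := by
      rw [show (8:ℝ) = 2 ^ 3 by norm_num, Real.log_pow]; norm_num
    rw [this]
    exact Real.log_le_log (by norm_num) (by norm_num)
  have ht' : (1:ℝ) ≤ t := by exact_mod_cast ht
  have hY' : Real.exp (-(Y:ℝ)) * Real.log 10 ≤ Real.exp (-(n:ℝ) ^ 5) := by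
    have h1 : (n:ℝ) ^ 6 ≤ Y := by exact_mod_cast hn1
    have h2 : (n:ℝ) ^ 5 + 3 ≤ (n:ℝ) ^ 6 := by
      have h3 : (1:ℝ) ≤ (n:ℝ) ^ 5 := one_le_pow₀ (by linarith)
      have : (n:ℝ) ^ 6 = n * n ^ 5 := by ring
      rw [this]
      nlinarith
    calc Real.exp (-(Y:ℝ)) * Real.log 10 ≤ Real.exp (-(n:ℝ) ^ 5 - 3) * Real.exp 3 := by
          gcongr
          · linarith
          · have := Real.add_one_le_exp (3:ℝ)
            linarith
      _ = _ := by rw [← Real.exp_add]; congr 1; ring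
  have hL : 0 < Real.log 10 := by linarith
  have e1 : |t * Real.logb 10 2 - a| = |(t - a) * Real.log 2 - a * Real.log 5| / Real.log 10 := by
    rw [eq_div_iff hL.ne', ← abs_of_pos hL, ← abs_mul, Real.logb, sub_mul]
    congr 1
    rw [mul_assoc, div_mul_cancel₀ _ hL.ne', hlog10]
    ring
  rw [e1, le_div_iff₀ hL]
  refine hY'.trans ?_
  have hsmall : Real.exp (-(n:ℝ) ^ 5) ≤ 1 / 2 := by
    have h3 : (2:ℝ) ≤ Real.exp ((n:ℝ) ^ 5) := by
      have h4 := Real.add_one_le_exp ((n:ℝ) ^ 5)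
      have : (n:ℝ) ≤ (n:ℝ) ^ 5 := le_self_pow₀ (by linarith) (by norm_num)
      linarith
    rw [Real.exp_neg, ← one_div]
    exact one_div_le_one_div_of_le (by norm_num) h3
  rcases le_or_gt a 0 with ha | ha
  · have ha' : (a:ℝ) ≤ 0 := by exact_mod_cast ha
    refine le_trans ?_ (le_abs_self _)
    nlinarith
  rcases le_or_gt (t:ℤ) a with hat | hat
  · have hat' : (t:ℝ) ≤ a := by exact_mod_cast hat
    refine le_trans ?_ (neg_le_abs _)
    nlinarith
  obtain ⟨b2, rfl⟩ := Int.eq_ofNat_of_zero_le ha.le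
  obtain ⟨b1, hb1⟩ := Nat.exists_eq_add_of_lt (by exact_mod_cast hat : b2 < t)
  have e2 : (t:ℝ) - ((b2:ℤ):ℝ) = ((b1 + 1 : ℕ) : ℝ) := by rw [hb1]; push_cast; ring
  rw [e2]
  have := gel_any n (b1 + 1) b2 hn1000 (by omega) (by exact_mod_cast ha) (by
    refine le_trans ?_ (hn0 n hnn0)
    have : b2 ≤ (n + 1) ^ (6 * A) := by
      calc b2 ≤ t := by omega
        _ ≤ Y ^ A := htY
        _ ≤ ((n + 1) ^ 6) ^ A := Nat.pow_le_pow_left hn2.le _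
        _ = _ := by rw [← pow_mul]
    have h2 : (b2:ℝ) ≤ ((n:ℝ) + 1) ^ (6 * A) := by exact_mod_cast this
    gcongr)
  simpa using this

noncomputable def ee (x : ℝ) : ℂ := Complex.exp (Complex.I * ((2 * Real.pi * x : ℝ) : ℂ))

theorem ee_norm (x : ℝ) : ‖ee x‖ = 1 := by
  unfold ee
  rw [mul_comm]
  exact Complex.norm_exp_ofReal_mul_I _

theorem ee_add (x y : ℝ) : ee (x + y) = ee x * ee y := by
  unfold ee
  rw [← Complex.exp_add]
  congr 1
  push_cast
  ring

theorem ee_zero : ee 0 = 1 := by simp [ee]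

theorem ee_int (a : ℤ) : ee a = 1 := by
  unfold ee
  rw [Complex.exp_eq_one_iff]
  refine ⟨a, ?_⟩
  push_cast
  ring

theorem ee_nat_mul (n : ℕ) (x : ℝ) : ee (n * x) = ee x ^ n := by
  unfold ee
  rw [← Complex.exp_nat_mul]
  congr 1
  push_cast
  ring

theorem ee_neg (x : ℝ) : ee (-x) = (starRingEnd ℂ) (ee x) := by
  unfold ee
  rw [← Complex.exp_conj]
  congr 1
  rw [map_mul, Complex.conj_I, Complex.conj_ofReal]
  push_cast
  ring

theorem geo (β η : ℝ) (hη : 0 < η) (h : ∀ a : ℤ, η ≤ |β - a|) (p q : ℕ) :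
    ‖∑ x ∈ Finset.Ico p q, ee (x * β)‖ ≤ 1 / η := by
  rcases le_or_gt q p with hpq | hpq
  · rw [Finset.Ico_eq_empty_of_le hpq]
    simp
    exact hη.le
  have h1 : 4 * η ≤ ‖ee β - 1‖ := by
    have e1 : ee β = ee (β - round β) := by
      have : β = (β - round β) + ((round β : ℤ) : ℝ) := by ring
      conv_lhs => rw [this]
      rw [ee_add, ee_int, mul_one]
    rw [e1]
    unfold ee
    rw [Complex.norm_exp_I_mul_ofReal_sub_one]
    have e2 : (2 * Real.pi * (β - round β)) / 2 = Real.pi * (β - round β) := by ring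
    rw [e2, norm_mul]
    have h2 := abs_sub_round β
    have h3 : |Real.pi * (β - round β)| ≤ Real.pi / 2 := by
      rw [abs_mul, abs_of_pos Real.pi_pos]
      nlinarith [Real.pi_pos]
    have h4 := Real.mul_abs_le_abs_sin h3
    rw [abs_mul, abs_of_pos Real.pi_pos] at h4
    have h5 : 2 / Real.pi * (Real.pi * |β - round β|) = 2 * |β - round β| := by
      field_simp
    rw [h5] at h4
    have h6 := h (round β)
    simp only [Real.norm_eq_abs]
    rw [abs_of_pos (by norm_num : (0:ℝ) < 2)]
    linarith
  have h2 : (∑ x ∈ Finset.Ico p q, ee (x * β)) * (ee β - 1) = ee β ^ q - ee β ^ p := by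
    rw [← geom_sum_Ico_mul _ hpq.le]
    congr 1
    exact Finset.sum_congr rfl (fun x _ => ee_nat_mul x β)
  have h3 : ‖∑ x ∈ Finset.Ico p q, ee (x * β)‖ * ‖ee β - 1‖ ≤ 2 := by
    rw [← norm_mul, h2]
    refine (norm_sub_le _ _).trans ?_
    rw [norm_pow, norm_pow, ee_norm]
    norm_num
  rw [le_div_iff₀ hη]
  have := norm_nonneg (∑ x ∈ Finset.Ico p q, ee (x * β))
  nlinarith

theorem abel (w : ℕ → ℝ) (hw : Monotone w) (h0 : ∀ x, 0 ≤ w x) (z : ℕ → ℂ) (B : ℝ) (p q : ℕ)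
    (hB : ∀ j, p ≤ j → ‖∑ x ∈ Finset.Ico j q, z x‖ ≤ B) :
    ‖∑ x ∈ Finset.Ico p q, (w x : ℂ) * z x‖ ≤ w q * B := by
  have hB0 : 0 ≤ B := (norm_nonneg _).trans (hB p le_rfl)
  have key : ∀ n, p + n ≤ q → ‖∑ x ∈ Finset.Ico p (p+n), (w x : ℂ) * z x + (w (p+n) : ℂ) * ∑ x ∈ Finset.Ico (p+n) q, z x‖ ≤ w (p+n) * B := by
    intro n
    induction n with
    | zero =>
      intro _
      simp only [add_zero, Finset.Ico_self, Finset.sum_empty, zero_add]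
      rw [norm_mul, Complex.norm_real, Real.norm_eq_abs, abs_of_nonneg (h0 p)]
      exact mul_le_mul_of_nonneg_left (hB p le_rfl) (h0 p)
    | succ n ih =>
      intro hn
      have ih := ih (by omega)
      have e1 : ∑ x ∈ Finset.Ico (p+n) q, z x = z (p+n) + ∑ x ∈ Finset.Ico (p+(n+1)) q, z x := by
        rw [Finset.sum_eq_sum_Ico_succ_bot (by omega)]
        rfl
      have e2 : ∑ x ∈ Finset.Ico p (p+(n+1)), (w x : ℂ) * z x = ∑ x ∈ Finset.Ico p (p+n), (w x : ℂ) * z x + w (p+n) * z (p+n) := by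
        rw [← add_assoc, Finset.sum_Ico_succ_top (by omega)]
      have e3 : ∑ x ∈ Finset.Ico p (p+(n+1)), (w x : ℂ) * z x + (w (p+(n+1)) : ℂ) * ∑ x ∈ Finset.Ico (p+(n+1)) q, z x
        = (∑ x ∈ Finset.Ico p (p+n), (w x : ℂ) * z x + (w (p+n) : ℂ) * ∑ x ∈ Finset.Ico (p+n) q, z x) + ((w (p+(n+1)) - w (p+n) : ℝ) : ℂ) * ∑ x ∈ Finset.Ico (p+(n+1)) q, z x := by
        rw [e1, e2]; push_cast; ring
      rw [e3]
      refine (norm_add_le _ _).trans ?_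
      have hm : 0 ≤ w (p+(n+1)) - w (p+n) := sub_nonneg.2 (hw (by omega))
      rw [norm_mul _ (∑ x ∈ Finset.Ico (p+(n+1)) q, z x), Complex.norm_real, Real.norm_eq_abs, abs_of_nonneg hm]
      have := mul_le_mul_of_nonneg_left (hB (p+(n+1)) (by omega)) hm
      linarith
  rcases le_or_gt q p with hpq | hpq
  · rw [Finset.Ico_eq_empty_of_le hpq]
    simp
    exact mul_nonneg (h0 _) hB0
  · have := key (q - p) (by omega)
    rw [show p + (q - p) = q by omega] at this
    simpa using this

theorem conv_sum (f g : ArithmeticFunction ℝ) (E : ℕ → ℂ) (N : ℕ) :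
    ∑ n ∈ Finset.Ioc 0 N, ((f * g) n : ℂ) * E n
      = ∑ m ∈ Finset.Ioc 0 N, ∑ k ∈ Finset.Ioc 0 (N / m), (f m : ℂ) * (g k : ℂ) * E (m * k) := by
  have h1 : ∑ n ∈ Finset.Ioc 0 N, ((f * g) n : ℂ) * E n
      = ∑ x ∈ Finset.Ioc 0 N ×ˢ Finset.Ioc 0 N with x.1 * x.2 ≤ N,
        (f x.1 : ℂ) * (g x.2 : ℂ) * E (x.1 * x.2) := by
    trans ∑ n ∈ Finset.Ioc 0 N, ∑ x ∈ Finset.Ioc 0 N ×ˢ Finset.Ioc 0 N with x.1 * x.2 = n,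
      (f x.1 : ℂ) * (g x.2 : ℂ) * E (x.1 * x.2)
    · refine Finset.sum_congr rfl fun n hn => ?_
      simp only [Finset.mem_Ioc] at hn
      rw [ArithmeticFunction.mul_apply, Nat.divisorsAntidiagonal_eq_prod_filter_of_le hn.1.ne' hn.2]
      push_cast
      rw [Finset.sum_mul]
      refine Finset.sum_congr rfl fun x hx => ?_
      rw [(Finset.mem_filter.1 hx).2]
    · simp_rw [Finset.sum_filter]
      rw [Finset.sum_comm]
      refine Finset.sum_congr rfl fun x hx => ?_
      simp only [Finset.mem_product, Finset.mem_Ioc] at hx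
      have : 0 < x.1 * x.2 := Nat.mul_pos hx.1.1 hx.2.1
      rw [Finset.sum_ite_eq]
      simp only [Finset.mem_Ioc, this, true_and]
  rw [h1, Finset.sum_filter, Finset.sum_product]
  refine Finset.sum_congr rfl fun m hm => ?_
  rw [← Finset.sum_filter]
  refine Finset.sum_congr ?_ fun _ _ => rfl
  ext k
  simp only [Finset.mem_filter, Finset.mem_Ioc, and_assoc] at hm ⊢
  constructor
  · rintro ⟨a, b, c⟩
    refine ⟨a, ?_⟩
    rw [Nat.le_div_iff_mul_le hm.1]; linarith
  · rintro ⟨a, b⟩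
    have b' := (Nat.le_div_iff_mul_le hm.1).1 b
    refine ⟨a, b.trans (Nat.div_le_self _ _), by linarith⟩

theorem typeI (c g : ArithmeticFunction ℝ) (θ η l : ℝ) (N V : ℕ) (hη : 0 < η) 
    (hc : ∀ m, m ≤ V → |c m| ≤ l) (hcV : ∀ m, V < m → c m = 0) (hg : Monotone g)
    (h : ∀ m : ℕ, 1 ≤ m → m ≤ V → ∀ a : ℤ, η ≤ |m * θ - a|) :
    ‖∑ n ∈ Finset.Ioc 0 N, ((c * g) n : ℂ) * ee (n * θ)‖ ≤ V * (l * (g (N+1) / η)) := by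
  have hg0 : ∀ x, 0 ≤ g x := fun x => by
    have := hg (Nat.zero_le x)
    simpa using this
  have hl : 0 ≤ l := (abs_nonneg _).trans (hc 0 (Nat.zero_le _))
  have hb : 0 ≤ l * (g (N+1) / η) := mul_nonneg hl (div_nonneg (hg0 _) hη.le)
  rw [conv_sum c g (fun n => ee (n * θ)) N]
  have key : ∀ m ∈ Finset.Ioc 0 N, ‖∑ k ∈ Finset.Ioc 0 (N / m), (c m : ℂ) * (g k : ℂ) * ee ((m * k : ℕ) * θ)‖
      ≤ if m ∈ Finset.Ioc 0 V then l * (g (N+1) / η) else 0 := by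
    intro m hm
    rw [Finset.mem_Ioc] at hm
    split_ifs with hV
    · rw [Finset.mem_Ioc] at hV
      have e : ∑ k ∈ Finset.Ioc 0 (N / m), (c m : ℂ) * (g k : ℂ) * ee ((m * k : ℕ) * θ)
          = (c m : ℂ) * ∑ k ∈ Finset.Ico 1 (N / m + 1), (g k : ℂ) * ee (k * (m * θ)) := by
        rw [Finset.mul_sum]
        refine Finset.sum_congr ?_ fun k _ => ?_
        · ext k; simp only [Finset.mem_Ioc, Finset.mem_Ico]; omega
        · rw [mul_assoc]; congr 3; push_cast; ring
      rw [e, norm_mul, Complex.norm_real, Real.norm_eq_abs]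
      have h1 := abel g hg hg0 (fun k => ee (k * (m * θ))) (1/η) 1 (N/m+1) 
        (fun j _ => geo _ _ hη (h m hV.1 hV.2) _ _)
      refine mul_le_mul (hc m hV.2) (h1.trans ?_) (norm_nonneg _) hl
      rw [mul_one_div]
      have : g (N/m+1) ≤ g (N+1) := hg (by have := Nat.div_le_self N m; omega)
      gcongr
    · have : c m = 0 := hcV m (by rw [Finset.mem_Ioc] at hV; omega)
      simp [this]
  refine (norm_sum_le _ _).trans ((Finset.sum_le_sum key).trans ?_)
  rw [Finset.sum_ite, Finset.sum_const_zero, add_zero, Finset.sum_const, nsmul_eq_mul]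
  refine mul_le_mul_of_nonneg_right ?_ hb
  have : (Finset.filter (fun x => x ∈ Finset.Ioc 0 V) (Finset.Ioc 0 N)).card ≤ (Finset.Ioc 0 V).card :=
    Finset.card_le_card (fun x hx => (Finset.mem_filter.1 hx).2)
  rw [Nat.card_Ioc] at this
  exact_mod_cast this

noncomputable def lo (U : ℕ) (f : ArithmeticFunction ℝ) : ArithmeticFunction ℝ :=
  ⟨fun n => if n ≤ U then f n else 0, by simp⟩
noncomputable def hi (U : ℕ) (f : ArithmeticFunction ℝ) : ArithmeticFunction ℝ :=
  ⟨fun n => if n ≤ U then 0 else f n, by simp⟩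

theorem lo_apply (U : ℕ) (f : ArithmeticFunction ℝ) (n : ℕ) : lo U f n = if n ≤ U then f n else 0 := rfl
theorem hi_apply (U : ℕ) (f : ArithmeticFunction ℝ) (n : ℕ) : hi U f n = if n ≤ U then 0 else f n := rfl

theorem lo_add_hi (U : ℕ) (f : ArithmeticFunction ℝ) : lo U f + hi U f = f := by
  ext n
  rw [ArithmeticFunction.add_apply, lo_apply, hi_apply]
  split_ifs <;> simp

open ArithmeticFunction in
theorem vaughan (U : ℕ) : (vonMangoldt : ArithmeticFunction ℝ) =
    lo U vonMangoldt + lo U (moebius : ArithmeticFunction ℝ) * ArithmeticFunction.log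
      - (lo U (moebius : ArithmeticFunction ℝ) * lo U vonMangoldt) * (zeta : ArithmeticFunction ℝ)
      + hi U (moebius : ArithmeticFunction ℝ) * ((zeta : ArithmeticFunction ℝ) * hi U vonMangoldt) := by
  have h1 := lo_add_hi U (moebius : ArithmeticFunction ℝ)
  have h2 := lo_add_hi U (vonMangoldt)
  have h3 : (zeta : ArithmeticFunction ℝ) * vonMangoldt = ArithmeticFunction.log := zeta_mul_vonMangoldt
  have h4 : (moebius : ArithmeticFunction ℝ) * (zeta : ArithmeticFunction ℝ) = 1 := coe_moebius_mul_coe_zeta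
  rw [← h3]
  generalize (zeta : ArithmeticFunction ℝ) = z at *
  generalize lo U (moebius : ArithmeticFunction ℝ) = m1 at *
  generalize hi U (moebius : ArithmeticFunction ℝ) = m2 at *
  generalize lo U vonMangoldt = L1 at *
  generalize hi U vonMangoldt = L2 at *
  generalize (moebius : ArithmeticFunction ℝ) = M at *
  subst h1
  rw [← h2]
  linear_combination -L2 * h4

open Classical in
theorem bad_count (θ δ : ℝ) (T y : ℕ) (hT : 1 ≤ T)
    (hd : ∀ d : ℕ, 1 ≤ d → d ≤ T → ∀ a : ℤ, 2 * δ ≤ |d * θ - a|) :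
    ((Finset.range y).filter (fun j : ℕ => ∃ a : ℤ, |j * θ - a| < δ)).card ≤ y / T + 1 := by
  rw [← Finset.card_range (y / T + 1)]
  have key : ∀ j j' : ℕ, j < j' → (∃ a : ℤ, |j * θ - a| < δ) → (∃ a : ℤ, |j' * θ - a| < δ) →
      j / T = j' / T → False := by
    rintro j j' hjj ⟨a, ha⟩ ⟨b, hb⟩ he
    have h1 : j' - j ≤ T := by
      have e1 := Nat.div_add_mod j T
      have e2 := Nat.div_add_mod j' T
      have e3 := Nat.mod_lt j' hT
      rw [he] at e1
      omega
    have h2 := hd (j' - j) (by omega) h1 (b - a)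
    rw [Nat.cast_sub hjj.le] at h2
    push_cast at h2
    have h3 : ((j':ℝ) - j) * θ - (b - a) = (j' * θ - b) - (j * θ - a) := by ring
    rw [h3] at h2
    have := abs_sub (j' * θ - b) (j * θ - a)
    linarith
  refine Finset.card_le_card_of_injOn (fun j => j / T) ?_ ?_
  · intro j hj
    have hj := Finset.mem_coe.1 hj
    rw [Finset.mem_filter, Finset.mem_range] at hj
    refine Finset.mem_coe.2 (Finset.mem_range.2 ?_)
    have := Nat.div_le_div_right (c := T) hj.1.le
    show j / T < _
    omega
  · intro j hj j' hj' he
    have hj := (Finset.mem_filter.1 (Finset.mem_coe.1 hj)).2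
    have hj' := (Finset.mem_filter.1 (Finset.mem_coe.1 hj')).2
    rcases lt_trichotomy j j' with h | h | h
    · exact (key j j' h hj hj' he).elim
    · exact h
    · exact (key j' j h hj' hj he.symm).elim

theorem inner_bound (θ δ : ℝ) (hδ : 0 < δ) (N T y s : ℕ) (hT : 1 ≤ T) (hy : 1 ≤ y) (hyN : y * y ≤ N)
    (hd : ∀ d : ℕ, 1 ≤ d → d ≤ T → ∀ a : ℤ, 2 * δ ≤ |d * θ - a|) :
    ∑ j ∈ Finset.range y, ‖∑ x ∈ Finset.Ico (y + s) (N / y + 1), (x : ℂ) * ee (x * (j * θ))‖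
      ≤ (N:ℝ)^2 / T * (1 / y) + (N:ℝ)^2 * (1 / (y:ℝ)^2) + 2 * N / δ := by
  classical
  have hyR : (1:ℝ) ≤ y := by exact_mod_cast hy
  have hTR : (1:ℝ) ≤ T := by exact_mod_cast hT
  have hy0 : (0:ℝ) < y := by linarith
  have hM : ((N / y : ℕ) : ℝ) ≤ N / y := Nat.cast_div_le
  have hM1 : (1:ℝ) ≤ N / y := by
    rw [le_div_iff₀ hy0]
    have : y ≤ N := by nlinarith
    rw [one_mul]; exact_mod_cast this
  have triv : ∀ j : ℕ, ‖∑ x ∈ Finset.Ico (y + s) (N / y + 1), (x : ℂ) * ee (x * (j * θ))‖ ≤ (N / y : ℝ)^2 := by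
    intro j
    refine (norm_sum_le _ _).trans ?_
    have : ∀ x ∈ Finset.Ico (y + s) (N / y + 1), ‖(x : ℂ) * ee (x * (j * θ))‖ ≤ (N / y : ℝ) := by
      intro x hx
      rw [Finset.mem_Ico] at hx
      rw [norm_mul, ee_norm, mul_one, Complex.norm_natCast]
      refine le_trans ?_ hM
      exact_mod_cast (by omega : x ≤ N / y)
    refine (Finset.sum_le_card_nsmul _ _ _ this).trans ?_
    rw [nsmul_eq_mul, sq, Nat.card_Ico]
    refine mul_le_mul_of_nonneg_right ?_ (by linarith)
    refine le_trans ?_ hM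
    have : ∀ M : ℕ, M + 1 - (y + s) ≤ M := fun M => by omega
    exact_mod_cast this _
  have good : ∀ j : ℕ, (¬ ∃ a : ℤ, |j * θ - a| < δ) → 
      ‖∑ x ∈ Finset.Ico (y + s) (N / y + 1), (x : ℂ) * ee (x * (j * θ))‖ ≤ 2 * (N / y : ℝ) / δ := by
    intro j hj
    push Not at hj
    have h1 := abel (fun x => (x:ℝ)) Nat.mono_cast (fun x => Nat.cast_nonneg x)
      (fun x => ee (x * (j * θ))) (1/δ) (y + s) (N / y + 1) (fun i _ => geo _ _ hδ hj _ _)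
    simp only [Complex.ofReal_natCast] at h1
    refine h1.trans ?_
    rw [mul_one_div]
    push_cast
    gcongr
    linarith
  rw [← Finset.sum_filter_add_sum_filter_not (Finset.range y) (fun j : ℕ => ∃ a : ℤ, |j * θ - a| < δ)]
  have hb := Finset.sum_le_card_nsmul ((Finset.range y).filter (fun j : ℕ => ∃ a : ℤ, |j * θ - a| < δ)) _ _ (fun j _ => triv j)
  have hg := Finset.sum_le_card_nsmul ((Finset.range y).filter (fun j : ℕ => ¬ ∃ a : ℤ, |j * θ - a| < δ)) _ _ (fun j hj => good j (Finset.mem_filter.1 hj).2)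
  have hbc := bad_count θ δ T y hT hd
  have hgc : ((Finset.range y).filter (fun j : ℕ => ¬ ∃ a : ℤ, |j * θ - a| < δ)).card ≤ y := by
    refine (Finset.card_filter_le _ _).trans ?_
    rw [Finset.card_range]
  rw [nsmul_eq_mul] at hb hg
  have hbc' : (((Finset.range y).filter (fun j : ℕ => ∃ a : ℤ, |j * θ - a| < δ)).card : ℝ) ≤ y / T + 1 := by
    have h2 : ((y / T : ℕ) : ℝ) ≤ y / T := Nat.cast_div_le
    have h3 : (((Finset.range y).filter (fun j : ℕ => ∃ a : ℤ, |j * θ - a| < δ)).card : ℝ) ≤ ((y / T + 1 : ℕ) : ℝ) := by exact_mod_cast hbc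
    push_cast at h3
    linarith
  have hgc' : (((Finset.range y).filter (fun j : ℕ => ¬ ∃ a : ℤ, |j * θ - a| < δ)).card : ℝ) ≤ y := by exact_mod_cast hgc
  have c1 := mul_le_mul_of_nonneg_right hbc' (sq_nonneg (N / y : ℝ))
  have c2 := mul_le_mul_of_nonneg_right hgc' (by positivity : 0 ≤ 2 * (N / y : ℝ) / δ)
  have e1 : ((y:ℝ) / T + 1) * (N / y : ℝ)^2 = (N:ℝ)^2 / T * (1 / y) + (N:ℝ)^2 * (1 / (y:ℝ)^2) := by
    field_simp
  have e2 : (y:ℝ) * (2 * (N / y : ℝ) / δ) = 2 * N / δ := by field_simp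
  linarith

theorem sum_sym (S : Finset ℕ) (K : ℕ → ℕ → ℝ) (h0 : ∀ a b, 0 ≤ K a b) (hs : ∀ a b, K a b = K b a) :
    ∑ a ∈ S, ∑ b ∈ S, K a b ≤ 2 * ∑ a ∈ S, ∑ b ∈ S with b ≤ a, K a b := by
  have h1 : ∀ a b, K a b ≤ (if b ≤ a then K a b else 0) + (if a ≤ b then K b a else 0) := by
    intro a b
    rcases le_total a b with h | h
    · rw [if_pos h, hs b a]
      have : 0 ≤ if b ≤ a then K a b else 0 := by split_ifs <;> simp [h0]
      linarith
    · rw [if_pos h]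
      have : 0 ≤ if a ≤ b then K b a else 0 := by split_ifs <;> simp [h0]
      linarith
  have h2 : ∑ a ∈ S, ∑ b ∈ S, K a b ≤ ∑ a ∈ S, ∑ b ∈ S, (if b ≤ a then K a b else 0) +
      ∑ a ∈ S, ∑ b ∈ S, (if a ≤ b then K b a else 0) := by
    rw [← Finset.sum_add_distrib]
    refine Finset.sum_le_sum fun a _ => ?_
    rw [← Finset.sum_add_distrib]
    exact Finset.sum_le_sum fun b _ => h1 a b
  rw [Finset.sum_comm (f := fun a b => if a ≤ b then K b a else 0)] at h2
  simp_rw [Finset.sum_filter]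
  linarith

theorem typeII_diag (θ δ H : ℝ) (hδ : 0 < δ) (N T U s : ℕ) (hT : 1 ≤ T) (hU : 1 ≤ U)
    (hd : ∀ d : ℕ, 1 ≤ d → d ≤ T → ∀ a : ℤ, 2 * δ ≤ |d * θ - a|)
    (hH : ∑ x ∈ Finset.Ioc 0 N, 1 / (x:ℝ) ≤ H) :
    ∑ y ∈ Finset.Ioc U N, ∑ j ∈ Finset.range y,
      ‖∑ x ∈ Finset.Ico (y + s) (N / y + 1), (x : ℂ) * ee (x * (j * θ))‖
      ≤ (N:ℝ)^2 / T * H + (N:ℝ)^2 / U + Real.sqrt N * (2 * N / δ) := by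
  have h1 : ∀ y ∈ Finset.Ioc U N, ∑ j ∈ Finset.range y,
      ‖∑ x ∈ Finset.Ico (y + s) (N / y + 1), (x : ℂ) * ee (x * (j * θ))‖
      ≤ (N:ℝ)^2 / T * (1 / y) + (N:ℝ)^2 * (1 / (y:ℝ)^2) + (if y * y ≤ N then 2 * N / δ else 0) := by
    intro y hy
    rw [Finset.mem_Ioc] at hy
    split_ifs with h
    · exact inner_bound θ δ hδ N T y s hT (by omega) h hd
    · have : N / y < y := (Nat.div_lt_iff_lt_mul (by omega)).2 (by omega)
      rw [Finset.Ico_eq_empty_of_le (by omega)]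
      simp
      positivity
  refine (Finset.sum_le_sum h1).trans ?_
  rw [Finset.sum_add_distrib, Finset.sum_add_distrib, ← Finset.mul_sum, ← Finset.mul_sum]
  gcongr
  · refine le_trans ?_ hH
    refine Finset.sum_le_sum_of_subset_of_nonneg ?_ (fun _ _ _ => by positivity)
    exact Finset.Ioc_subset_Ioc_left (Nat.zero_le _)
  · rw [div_eq_mul_inv]
    gcongr
    rcases le_or_gt U N with h | h
    · have := sum_Ioc_inv_sq_le_sub (α := ℝ) (k := U) (n := N) (by omega) h
      simp only [one_div]
      have h3 : (0:ℝ) ≤ (N:ℝ)⁻¹ := by positivity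
      linarith
    · rw [Finset.Ioc_eq_empty_of_le h.le]
      simp
  · rw [← Finset.sum_filter, Finset.sum_const, nsmul_eq_mul]
    gcongr
    have h2 : ((Finset.Ioc U N).filter (fun y => y * y ≤ N)).card ≤ (Finset.Ioc 0 (Nat.sqrt N)).card := by
      refine Finset.card_le_card fun y hy => ?_
      rw [Finset.mem_filter, Finset.mem_Ioc] at hy
      rw [Finset.mem_Ioc]
      exact ⟨by omega, Nat.le_sqrt.2 hy.2⟩
    rw [Nat.card_Ioc, Nat.sub_zero] at h2
    refine le_trans (by exact_mod_cast h2) (Real.nat_sqrt_le_real_sqrt)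

theorem K_eq (θ : ℝ) (N y y' s : ℕ) (hy : 1 ≤ y) (hyy : y' ≤ y) :
    (∑ x ∈ Finset.Ioc 0 N, if (y + s ≤ x ∧ x * y ≤ N) ∧ (y' + s ≤ x ∧ x * y' ≤ N) then
      (x:ℂ) * (ee (x * (y * θ)) * (starRingEnd ℂ) (ee (x * (y' * θ)))) else 0)
    = ∑ x ∈ Finset.Ico (y + s) (N / y + 1), (x : ℂ) * ee (x * ((y - y' : ℕ) * θ)) := by
  rw [← Finset.sum_filter]
  refine Finset.sum_congr ?_ ?_
  · ext x
    simp only [Finset.mem_filter, Finset.mem_Ioc, Finset.mem_Ico, Nat.lt_succ_iff, 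
      Nat.le_div_iff_mul_le hy]
    constructor
    · rintro ⟨_, h, _⟩; exact h
    · rintro ⟨h1, h2⟩
      have h3 : x * y' ≤ x * y := Nat.mul_le_mul_left _ hyy
      have h4 : x ≤ x * y := Nat.le_mul_of_pos_right _ hy
      refine ⟨⟨by omega, by omega⟩, ⟨h1, h2⟩, by omega, by omega⟩
  · intro x _
    rw [← ee_neg, ← ee_add, Nat.cast_sub hyy]
    congr 2
    ring

theorem typeII (θ δ H l : ℝ) (hδ : 0 < δ) (N T U s : ℕ) (hT : 1 ≤ T) (hU : 1 ≤ U)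
    (hd : ∀ d : ℕ, 1 ≤ d → d ≤ T → ∀ a : ℤ, 2 * δ ≤ |d * θ - a|)
    (hH : ∑ x ∈ Finset.Ioc 0 N, 1 / (x:ℝ) ≤ H) (u v : ℕ → ℝ) (hl : 0 ≤ l)
    (hu : ∀ x ∈ Finset.Ioc 0 N, |u x| ≤ l) (hv : ∀ x ∈ Finset.Ioc 0 N, |v x| ≤ l) :
    ‖∑ x ∈ Finset.Ioc 0 N, ∑ y ∈ Finset.Ioc U N, if (y + s ≤ x ∧ x * y ≤ N) then
      (u x : ℂ) * ((v y : ℂ) * ee (x * (y * θ))) else 0‖ ^ 2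
      ≤ l ^ 4 * H * (2 * ((N:ℝ)^2 / T * H + (N:ℝ)^2 / U + Real.sqrt N * (2 * N / δ))) := by
  set G : ℕ → ℂ := fun x => ∑ y ∈ Finset.Ioc U N, if (y + s ≤ x ∧ x * y ≤ N) then
    ((v y : ℂ) * ee (x * (y * θ))) else 0 with hG
  set K : ℕ → ℕ → ℂ := fun y y' => ∑ x ∈ Finset.Ioc 0 N, if (y + s ≤ x ∧ x * y ≤ N) ∧ (y' + s ≤ x ∧ x * y' ≤ N) then
      (x:ℂ) * (ee (x * (y * θ)) * (starRingEnd ℂ) (ee (x * (y' * θ)))) else 0 with hK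
  have eZ : ∀ x, ∑ y ∈ Finset.Ioc U N, (if (y + s ≤ x ∧ x * y ≤ N) then
      (u x : ℂ) * ((v y : ℂ) * ee (x * (y * θ))) else 0) = u x * G x := by
    intro x
    rw [hG, Finset.mul_sum]
    refine Finset.sum_congr rfl fun y _ => ?_
    split_ifs <;> simp
  simp_rw [eZ]
  have A : ‖∑ x ∈ Finset.Ioc 0 N, (u x : ℂ) * G x‖ ^ 2 ≤ 
      (∑ x ∈ Finset.Ioc 0 N, (u x)^2 / x) * ∑ x ∈ Finset.Ioc 0 N, (x:ℝ) * ‖G x‖^2 := by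
    have : ‖∑ x ∈ Finset.Ioc 0 N, (u x : ℂ) * G x‖ ≤ ∑ x ∈ Finset.Ioc 0 N, |u x| * ‖G x‖ := by
      refine (norm_sum_le _ _).trans (le_of_eq ?_)
      refine Finset.sum_congr rfl fun x _ => ?_
      rw [norm_mul, Complex.norm_real, Real.norm_eq_abs]
    refine (pow_le_pow_left₀ (norm_nonneg _) this 2).trans ?_
    refine Finset.sum_sq_le_sum_mul_sum_of_sq_le_mul _ (fun _ _ => by positivity) (fun _ _ => by positivity) ?_
    intro x hx
    rw [Finset.mem_Ioc] at hx
    have : (x:ℝ) ≠ 0 := by exact_mod_cast (by omega)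
    rw [mul_pow, sq_abs]
    refine le_of_eq ?_
    field_simp
  have A2 : (∑ x ∈ Finset.Ioc 0 N, (u x)^2 / x) ≤ l ^ 2 * H := by
    refine le_trans ?_ (mul_le_mul_of_nonneg_left hH (sq_nonneg l))
    rw [Finset.mul_sum]
    refine Finset.sum_le_sum fun x hx => ?_
    rw [mul_one_div]
    refine div_le_div_of_nonneg_right ?_ (Nat.cast_nonneg _)
    exact sq_le_sq' (by linarith [neg_abs_le (u x), hu x hx]) (by linarith [le_abs_self (u x), hu x hx])
  have B1 : ((∑ x ∈ Finset.Ioc 0 N, (x:ℝ) * ‖G x‖^2 : ℝ) : ℂ) = 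
      ∑ y ∈ Finset.Ioc U N, ∑ y' ∈ Finset.Ioc U N, ((v y : ℂ) * (v y' : ℂ)) * K y y' := by
    have e1 : ∀ x : ℕ, (((x:ℝ) * ‖G x‖^2 : ℝ) : ℂ) = ∑ y ∈ Finset.Ioc U N, ∑ y' ∈ Finset.Ioc U N,
        ((v y : ℂ) * (v y' : ℂ)) * (if (y + s ≤ x ∧ x * y ≤ N) ∧ (y' + s ≤ x ∧ x * y' ≤ N) then
      (x:ℂ) * (ee (x * (y * θ)) * (starRingEnd ℂ) (ee (x * (y' * θ)))) else 0) := by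
      intro x
      push_cast
      rw [← Complex.mul_conj', hG, map_sum, Finset.sum_mul_sum, Finset.mul_sum]
      refine Finset.sum_congr rfl fun y _ => ?_
      rw [Finset.mul_sum]
      refine Finset.sum_congr rfl fun y' _ => ?_
      by_cases h1 : (y + s ≤ x ∧ x * y ≤ N) <;> by_cases h2 : (y' + s ≤ x ∧ x * y' ≤ N) <;>
        simp only [h1, h2, if_true, if_false, and_self, and_true, and_false, true_and, false_and, map_zero, mul_zero, zero_mul]
      rw [map_mul, Complex.conj_ofReal]
      ring
    rw [Complex.ofReal_sum]
    simp_rw [e1]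
    rw [Finset.sum_comm]
    refine Finset.sum_congr rfl fun y _ => ?_
    rw [Finset.sum_comm]
    refine Finset.sum_congr rfl fun y' _ => ?_
    rw [← Finset.mul_sum]
  have B2 : ∑ x ∈ Finset.Ioc 0 N, (x:ℝ) * ‖G x‖^2 ≤ l ^ 2 * ∑ y ∈ Finset.Ioc U N, ∑ y' ∈ Finset.Ioc U N, ‖K y y'‖ := by
    have hn : 0 ≤ ∑ x ∈ Finset.Ioc 0 N, (x:ℝ) * ‖G x‖^2 := Finset.sum_nonneg fun _ _ => by positivity
    rw [← abs_of_nonneg hn, ← Real.norm_eq_abs, ← Complex.norm_real, B1, Finset.mul_sum]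
    refine (norm_sum_le _ _).trans (Finset.sum_le_sum fun y hy => ?_)
    rw [Finset.mul_sum]
    refine (norm_sum_le _ _).trans (Finset.sum_le_sum fun y' hy' => ?_)
    rw [norm_mul, norm_mul, Complex.norm_real, Complex.norm_real, Real.norm_eq_abs, Real.norm_eq_abs, sq]
    have hs : Finset.Ioc U N ⊆ Finset.Ioc 0 N := Finset.Ioc_subset_Ioc_left (Nat.zero_le _)
    have h1 := hv y (hs hy)
    have h2 := hv y' (hs hy')
    gcongr
  have hsym : ∀ a b, ‖K a b‖ = ‖K b a‖ := by
    intro a b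
    have : K b a = (starRingEnd ℂ) (K a b) := by
      simp only [hK]
      rw [map_sum]
      refine Finset.sum_congr rfl fun x _ => ?_
      by_cases h1 : (a + s ≤ x ∧ x * a ≤ N) <;> by_cases h2 : (b + s ≤ x ∧ x * b ≤ N) <;>
        simp only [h1, h2, if_true, if_false, and_self, and_true, and_false, true_and, false_and, map_zero]
      rw [map_mul, map_mul, Complex.conj_conj, Complex.conj_natCast]
      ring
    rw [this, Complex.norm_conj]
  have C := sum_sym (Finset.Ioc U N) (fun a b => ‖K a b‖) (fun _ _ => norm_nonneg _) hsym
  have D : ∑ a ∈ Finset.Ioc U N, ∑ b ∈ Finset.Ioc U N with b ≤ a, ‖K a b‖ ≤ 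
      ∑ y ∈ Finset.Ioc U N, ∑ j ∈ Finset.range y,
      ‖∑ x ∈ Finset.Ico (y + s) (N / y + 1), (x : ℂ) * ee (x * (j * θ))‖ := by
    refine Finset.sum_le_sum fun a ha => ?_
    rw [Finset.mem_Ioc] at ha
    set L : ℕ → ℝ := fun j => ‖∑ x ∈ Finset.Ico (a + s) (N / a + 1), (x : ℂ) * ee (x * (j * θ))‖ with hL
    have e1 : ∑ b ∈ Finset.Ioc U N with b ≤ a, ‖K a b‖ = ∑ b ∈ Finset.Ioc U N with b ≤ a, L (a - b) := by
      refine Finset.sum_congr rfl fun b hb => ?_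
      rw [Finset.mem_filter] at hb
      simp only [hK, hL]
      rw [K_eq θ N a b s (by omega) hb.2]
    rw [e1, ← Finset.sum_image (f := L) (g := fun b => a - b)]
    · refine Finset.sum_le_sum_of_subset_of_nonneg ?_ (fun _ _ _ => norm_nonneg _)
      intro j hj
      rw [Finset.mem_image] at hj
      obtain ⟨b, hb, rfl⟩ := hj
      rw [Finset.mem_filter, Finset.mem_Ioc] at hb
      rw [Finset.mem_range]
      omega
    · intro b hb c hc h
      have hb := (Finset.mem_filter.1 (Finset.mem_coe.1 hb)).2
      have hc := (Finset.mem_filter.1 (Finset.mem_coe.1 hc)).2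
      simp only at h
      omega
  have E := typeII_diag θ δ H hδ N T U s hT hU hd hH
  have hH0 : 0 ≤ H := le_trans (Finset.sum_nonneg fun _ _ => by positivity) hH
  have F : ∑ x ∈ Finset.Ioc 0 N, (x:ℝ) * ‖G x‖^2 ≤ l ^ 2 * (2 * ((N:ℝ)^2 / T * H + (N:ℝ)^2 / U + Real.sqrt N * (2 * N / δ))) :=
    B2.trans (mul_le_mul_of_nonneg_left (by linarith) (sq_nonneg l))
  refine A.trans ((mul_le_mul A2 F (Finset.sum_nonneg fun _ _ => by positivity) (by positivity)).trans (le_of_eq ?_))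
  ring

theorem bil_split (a b : ArithmeticFunction ℝ) (θ : ℝ) (N U : ℕ) (ha : ∀ n ≤ U, a n = 0) (hb : ∀ n ≤ U, b n = 0) :
    ∑ n ∈ Finset.Ioc 0 N, ((a * b) n : ℂ) * ee (n * θ) = 
    (∑ x ∈ Finset.Ioc 0 N, ∑ y ∈ Finset.Ioc U N, if (y + 0 ≤ x ∧ x * y ≤ N) then
      (a x : ℂ) * ((b y : ℂ) * ee (x * (y * θ))) else 0) + 
    (∑ x ∈ Finset.Ioc 0 N, ∑ y ∈ Finset.Ioc U N, if (y + 1 ≤ x ∧ x * y ≤ N) then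
      (b x : ℂ) * ((a y : ℂ) * ee (x * (y * θ))) else 0) := by
  have ext : ∀ (v : ArithmeticFunction ℝ) (_ : ∀ n ≤ U, v n = 0) (u : ℕ → ℝ) (s x : ℕ),
      (∑ y ∈ Finset.Ioc U N, if (y + s ≤ x ∧ x * y ≤ N) then
      (u x : ℂ) * ((v y : ℂ) * ee (x * (y * θ))) else 0) = 
      ∑ y ∈ Finset.Ioc 0 N, if (y + s ≤ x ∧ x * y ≤ N) then
      (u x : ℂ) * ((v y : ℂ) * ee (x * (y * θ))) else 0 := by
    intro v hv u s x
    refine Finset.sum_subset (Finset.Ioc_subset_Ioc_left (Nat.zero_le _)) ?_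
    intro y h1 h2
    rw [Finset.mem_Ioc] at h1 h2
    rw [hv y (by omega)]
    simp
  rw [conv_sum a b (fun n => ee (n * θ)) N]
  simp_rw [ext b hb a 0, ext a ha b 1]
  rw [Finset.sum_comm (f := fun x y => if (y + 1 ≤ x ∧ x * y ≤ N) then
      (b x : ℂ) * ((a y : ℂ) * ee (x * (y * θ))) else 0), ← Finset.sum_add_distrib]
  refine Finset.sum_congr rfl fun m hm => ?_
  rw [Finset.mem_Ioc] at hm
  rw [← Finset.sum_add_distrib]
  have e1 : Finset.Ioc 0 (N / m) = (Finset.Ioc 0 N).filter (fun k => m * k ≤ N) := by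
    ext k
    simp only [Finset.mem_filter, Finset.mem_Ioc]
    rw [Nat.le_div_iff_mul_le hm.1, mul_comm k m]
    constructor
    · rintro ⟨h1, h2⟩
      exact ⟨⟨h1, le_trans (Nat.le_mul_of_pos_left _ hm.1) h2⟩, h2⟩
    · rintro ⟨⟨h1, _⟩, h2⟩
      exact ⟨h1, h2⟩
  rw [e1, Finset.sum_filter]
  refine Finset.sum_congr rfl fun k _ => ?_
  have e2 : ((m * k : ℕ) : ℝ) * θ = m * (k * θ) := by push_cast; ring
  have e3 : (k : ℝ) * (m * θ) = m * (k * θ) := by ring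
  rw [e2, e3, mul_comm k m]
  by_cases h1 : m * k ≤ N
  · rcases le_or_gt k m with h2 | h2
    · rw [if_pos h1, if_pos ⟨by omega, h1⟩, if_neg (by omega)]
      ring
    · rw [if_pos h1, if_neg (by omega), if_pos ⟨by omega, h1⟩]
      ring
  · simp [h1]

open ArithmeticFunction in
theorem mu_abs (n : ℕ) : |(moebius : ArithmeticFunction ℝ) n| ≤ 1 := by
  rw [intCoe_apply]
  have := abs_moebius_le_one (n := n)
  exact_mod_cast this

open ArithmeticFunction in
theorem lolo_bound (U n : ℕ) : |(lo U (moebius : ArithmeticFunction ℝ) * lo U vonMangoldt) n| ≤ Real.log n := by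
  rw [← vonMangoldt_sum, mul_apply]
  refine (Finset.abs_sum_le_sum_abs _ _).trans ?_
  rw [← Nat.sum_divisorsAntidiagonal' (f := fun _ i => vonMangoldt i)]
  refine Finset.sum_le_sum fun x _ => ?_
  rw [abs_mul, lo_apply, lo_apply]
  have h1 := mu_abs x.1
  have h2 : 0 ≤ vonMangoldt x.2 := vonMangoldt_nonneg
  split_ifs
  · rw [abs_of_nonneg h2]; nlinarith
  all_goals simpa using h2

open ArithmeticFunction in
theorem lolo_zero (U n : ℕ) (hn : U * U < n) : (lo U (moebius : ArithmeticFunction ℝ) * lo U vonMangoldt) n = 0 := by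
  rw [mul_apply]
  refine Finset.sum_eq_zero fun x hx => ?_
  rw [Nat.mem_divisorsAntidiagonal] at hx
  rw [lo_apply, lo_apply]
  by_cases h1 : x.1 ≤ U
  · by_cases h2 : x.2 ≤ U
    · have := Nat.mul_le_mul h1 h2
      omega
    · simp [h2]
  · simp [h1]

open ArithmeticFunction in
theorem zhi_bound (U n : ℕ) : |((zeta : ArithmeticFunction ℝ) * hi U vonMangoldt) n| ≤ Real.log n := by
  rw [coe_zeta_mul_apply, ← vonMangoldt_sum]
  refine (Finset.abs_sum_le_sum_abs _ _).trans ?_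
  refine Finset.sum_le_sum fun x _ => ?_
  have h2 : 0 ≤ vonMangoldt x := vonMangoldt_nonneg
  rw [hi_apply]
  split_ifs
  · simpa using h2
  · rw [abs_of_nonneg h2]

open ArithmeticFunction in
theorem zhi_zero (U n : ℕ) (hn : n ≤ U) : ((zeta : ArithmeticFunction ℝ) * hi U vonMangoldt) n = 0 := by
  rw [coe_zeta_mul_apply]
  refine Finset.sum_eq_zero fun x hx => ?_
  have := Nat.divisor_le hx
  rw [hi_apply, if_pos (by omega)]

open ArithmeticFunction in
theorem vaughan_bound (θ η H l : ℝ) (hη : 0 < η) (N U : ℕ) (hU : 1 ≤ U) (hUN : U * U ≤ N)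
    (hd : ∀ d : ℕ, 1 ≤ d → d ≤ U * U → ∀ a : ℤ, η ≤ |d * θ - a|)
    (hH : ∑ x ∈ Finset.Ioc 0 N, 1 / (x:ℝ) ≤ H) (hl : 1 ≤ l) (hlN : Real.log (N + 1 : ℕ) ≤ l) :
    ‖∑ n ∈ Finset.Ioc 0 N, (vonMangoldt n : ℂ) * ee (n * θ)‖ ≤
      U * l + U * (l / η) + (U * U) * (l / η) + 
      2 * Real.sqrt (l ^ 4 * H * (2 * ((N:ℝ)^2 / (U * U) * H + (N:ℝ)^2 / U + Real.sqrt N * (4 * N / η)))) := by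
  have hlog : ∀ n : ℕ, n ≤ N → Real.log n ≤ l := by
    intro n hn
    refine le_trans ?_ hlN
    rcases Nat.eq_zero_or_pos n with h | h
    · subst h; simpa using Real.log_natCast_nonneg (N+1)
    · exact Real.log_le_log (by exact_mod_cast h) (by exact_mod_cast (by omega))
  have hUU : U ≤ U * U := Nat.le_mul_of_pos_left _ hU
  have h1 : ‖∑ n ∈ Finset.Ioc 0 N, (lo U vonMangoldt n : ℂ) * ee (n * θ)‖ ≤ U * l := by
    have : ∀ n ∈ Finset.Ioc 0 N, ‖(lo U vonMangoldt n : ℂ) * ee (n * θ)‖ ≤ if n ∈ Finset.Ioc 0 U then l else 0 := by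
      intro n hn
      rw [Finset.mem_Ioc] at hn
      rw [norm_mul, ee_norm, mul_one, Complex.norm_real, Real.norm_eq_abs, lo_apply]
      by_cases h : n ≤ U
      · rw [if_pos h, if_pos (Finset.mem_Ioc.2 ⟨hn.1, h⟩), abs_of_nonneg vonMangoldt_nonneg]
        exact vonMangoldt_le_log.trans (hlog n hn.2)
      · rw [if_neg h, if_neg (fun h' => h (Finset.mem_Ioc.1 h').2)]
        simp
    refine (norm_sum_le _ _).trans ((Finset.sum_le_sum this).trans ?_)
    rw [Finset.sum_ite, Finset.sum_const_zero, add_zero, Finset.sum_const, nsmul_eq_mul]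
    refine mul_le_mul_of_nonneg_right ?_ (by linarith)
    have : (Finset.filter (fun x => x ∈ Finset.Ioc 0 U) (Finset.Ioc 0 N)).card ≤ (Finset.Ioc 0 U).card :=
      Finset.card_le_card (fun x hx => (Finset.mem_filter.1 hx).2)
    rw [Nat.card_Ioc] at this
    exact_mod_cast this
  have h2 := typeI (lo U (moebius : ArithmeticFunction ℝ)) ArithmeticFunction.log θ η 1 N U hη
    (fun m hm => by rw [lo_apply, if_pos hm]; exact mu_abs m)
    (fun m hm => by rw [lo_apply, if_neg (by omega)])
    (fun a b h => by
      rw [log_apply, log_apply]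
      rcases Nat.eq_zero_or_pos a with h' | h'
      · subst h'; simpa using Real.log_natCast_nonneg b
      · exact Real.log_le_log (by exact_mod_cast h') (by exact_mod_cast h))
    (fun m hm hm2 => hd m hm (hm2.trans hUU))
  have h3 := typeI (lo U (moebius : ArithmeticFunction ℝ) * lo U vonMangoldt) (zeta : ArithmeticFunction ℝ) θ η l N (U * U) hη
    (fun m hm => (lolo_bound U m).trans (hlog m (hm.trans hUN)))
    (fun m hm => lolo_zero U m hm)
    (fun a b h => by
      simp only [natCoe_apply, zeta_apply]
      split_ifs
      · simp
      · simp
      · omega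
      · simp)
    (fun m hm hm2 => hd m hm hm2)
  have hmu : ∀ x ∈ Finset.Ioc 0 N, |hi U (moebius : ArithmeticFunction ℝ) x| ≤ l := by
    intro x _
    rw [hi_apply]
    split_ifs
    · simp; linarith
    · exact (mu_abs x).trans hl
  have hz : ∀ x ∈ Finset.Ioc 0 N, |((zeta : ArithmeticFunction ℝ) * hi U vonMangoldt) x| ≤ l := by
    intro x hx
    exact (zhi_bound U x).trans (hlog x (Finset.mem_Ioc.1 hx).2)
  have hT : 1 ≤ U * U := by omega
  have hd' : ∀ d : ℕ, 1 ≤ d → d ≤ U * U → ∀ a : ℤ, 2 * (η / 2) ≤ |d * θ - a| := by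
    intro d h1 h2 a
    have := hd d h1 h2 a
    linarith
  have h4 := typeII θ (η/2) H l (by linarith) N (U*U) U 0 hT hU hd' hH _ _ (by linarith) hmu hz
  have h5 := typeII θ (η/2) H l (by linarith) N (U*U) U 1 hT hU hd' hH _ _ (by linarith) hz hmu
  have eη : 2 * (N:ℝ) / (η / 2) = 4 * N / η := by field_simp; ring
  rw [eη] at h4 h5
  push_cast at h4 h5
  have h4 := Real.le_sqrt_of_sq_le h4
  have h5 := Real.le_sqrt_of_sq_le h5
  have hbil := bil_split (hi U (moebius : ArithmeticFunction ℝ)) ((zeta : ArithmeticFunction ℝ) * hi U vonMangoldt) θ N U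
    (fun n hn => by rw [hi_apply, if_pos hn]) (fun n hn => zhi_zero U n hn)
  have hsplit : ∑ n ∈ Finset.Ioc 0 N, (vonMangoldt n : ℂ) * ee (n * θ) = 
      ∑ n ∈ Finset.Ioc 0 N, (lo U vonMangoldt n : ℂ) * ee (n * θ)
      + ∑ n ∈ Finset.Ioc 0 N, ((lo U (moebius : ArithmeticFunction ℝ) * ArithmeticFunction.log) n : ℂ) * ee (n * θ)
      - ∑ n ∈ Finset.Ioc 0 N, ((lo U (moebius : ArithmeticFunction ℝ) * lo U vonMangoldt * (zeta : ArithmeticFunction ℝ)) n : ℂ) * ee (n * θ)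
      + ∑ n ∈ Finset.Ioc 0 N, ((hi U (moebius : ArithmeticFunction ℝ) * ((zeta : ArithmeticFunction ℝ) * hi U vonMangoldt)) n : ℂ) * ee (n * θ) := by
    rw [← Finset.sum_add_distrib, ← Finset.sum_sub_distrib, ← Finset.sum_add_distrib]
    refine Finset.sum_congr rfl fun n _ => ?_
    have hv := congrArg (fun f : ArithmeticFunction ℝ => f n) (vaughan U)
    simp only [sub_eq_add_neg, ArithmeticFunction.add_apply, ArithmeticFunction.neg_apply] at hv
    rw [hv]
    push_cast
    ring
  rw [hsplit, hbil]
  have g2 : (U:ℝ) * (1 * (ArithmeticFunction.log (N+1) / η)) ≤ U * (l / η) := by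
    rw [one_mul, log_apply]
    gcongr
  have g3 : ((U * U : ℕ):ℝ) * (l * ((zeta : ArithmeticFunction ℝ) (N+1) / η)) = (U * U) * (l / η) := by
    rw [natCoe_apply, zeta_apply, if_neg (by omega)]
    push_cast
    ring
  rw [g3] at h3
  refine (norm_add_le _ _).trans ?_
  refine (add_le_add ((norm_sub_le _ _).trans (add_le_add (norm_add_le _ _) le_rfl)) (norm_add_le _ _)).trans ?_
  linarith

theorem harm_le (N : ℕ) : ∑ x ∈ Finset.Ioc 0 N, 1 / (x:ℝ) ≤ 1 + Real.log N := by
  have h := harmonic_le_one_add_log N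
  rw [harmonic_eq_sum_Icc] at h
  push_cast at h
  refine le_trans (le_of_eq ?_) h
  refine Finset.sum_congr ?_ fun x _ => by rw [one_div]
  ext x
  simp only [Finset.mem_Ioc, Finset.mem_Icc]
  omega

theorem num_bound (N Y X : ℝ) (hY : 2 ≤ Y) (hX : Y ^ 7 ≤ X) (hN : X ^ 8 ≤ N) :
    Y^7 * (16*Y) + Y^7 * (16 * Y * X) + (Y^7 * Y^7) * (16 * Y * X) + 
      2 * Real.sqrt ((16*Y) ^ 4 * (16*Y) * (2 * (N^2 / (Y^7 * Y^7) * (16*Y) + N^2 / Y^7 + Real.sqrt N * (4 * N * X))))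
    ≤ 30000 * N / Y := by
  have hY0 : 0 < Y := by linarith
  have hY1 : 1 ≤ Y := by linarith
  have p1 : Y ≤ Y^7 := le_self_pow₀ hY1 (by norm_num)
  have hX1 : 1 ≤ X := by linarith
  have hX0 : 0 < X := by linarith
  have hN0 : 0 < N := lt_of_lt_of_le (by positivity) hN
  have hY14 : Y^14 ≤ X^2 := by
    have := pow_le_pow_left₀ (by positivity) hX 2
    calc Y^14 = (Y^7)^2 := by ring
      _ ≤ _ := this
  have hYX : Y ≤ X := p1.trans hX
  -- type I
  have hA : Y^7 * (16*Y) + Y^7 * (16 * Y * X) + (Y^7 * Y^7) * (16 * Y * X) ≤ 48 * N / Y := by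
    rw [le_div_iff₀ hY0]
    have q1 : Y^9 ≤ X^2 := (pow_le_pow_right₀ hY1 (by norm_num)).trans hY14
    have q2 : Y^16 ≤ X^4 := by
      calc Y^16 = Y^14 * Y * Y := by ring
        _ ≤ X^2 * X * X := by gcongr
        _ = X^4 := by ring
    have q3 : X^2 ≤ X^8 := pow_le_pow_right₀ hX1 (by norm_num)
    have q4 : X^3 ≤ X^8 := pow_le_pow_right₀ hX1 (by norm_num)
    have q5 : X^5 ≤ X^8 := pow_le_pow_right₀ hX1 (by norm_num)
    have q6 : Y^9 * X ≤ X^3 := by nlinarith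
    have q7 : Y^16 * X ≤ X^5 := by nlinarith
    nlinarith
  have hB : Real.sqrt ((16*Y) ^ 4 * (16*Y) * (2 * (N^2 / (Y^7 * Y^7) * (16*Y) + N^2 / Y^7 + Real.sqrt N * (4 * N * X)))) ≤ 10000 * N / Y := by
    apply Real.sqrt_le_iff.2 ⟨by positivity, ?_⟩
    have hs : Real.sqrt N * X ≤ N / Y^7 := by
      have hs0 : X^4 ≤ Real.sqrt N := by
        apply Real.le_sqrt_of_sq_le
        calc (X^4)^2 = X^8 := by ring
          _ ≤ N := hN
      rw [le_div_iff₀ (by positivity)]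
      calc Real.sqrt N * X * Y^7 ≤ Real.sqrt N * X * X := by gcongr
        _ = Real.sqrt N * X^2 := by ring
        _ ≤ Real.sqrt N * X^4 := by gcongr; norm_num
        _ ≤ Real.sqrt N * Real.sqrt N := by gcongr
        _ = N := Real.mul_self_sqrt hN0.le
    have h1 : Real.sqrt N * (4 * N * X) ≤ 4 * (N^2 / Y^7) := by
      calc Real.sqrt N * (4 * N * X) = 4 * N * (Real.sqrt N * X) := by ring
        _ ≤ 4 * N * (N / Y^7) := by gcongr
        _ = _ := by ring
    have h2 : N^2 / (Y^7 * Y^7) * (16*Y) ≤ 16 * (N^2 / Y^7) := by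
      have e : N^2 / (Y^7 * Y^7) * (16*Y) = 16 * (N^2 / Y^7) * (Y / Y^7) := by field_simp
      rw [e]
      have : Y / Y^7 ≤ 1 := (div_le_one (by positivity)).2 p1
      have h0 : 0 ≤ 16 * (N^2 / Y^7) := by positivity
      nlinarith
    calc _ ≤ (16*Y) ^ 4 * (16*Y) * (2 * (16 * (N^2 / Y^7) + N^2 / Y^7 + 4 * (N^2 / Y^7))) := by gcongr
      _ = (16^5 * 42) * (N / Y)^2 := by field_simp; ring
      _ ≤ 10000^2 * (N / Y)^2 := by gcongr; norm_num
      _ = _ := by ring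
  have e : 30000 * N / Y = 48 * N / Y + 2 * (10000 * N / Y) + 9952 * N / Y := by ring
  have : 0 ≤ 9952 * N / Y := by positivity
  linarith

open ArithmeticFunction in
theorem S_bound (θ : ℝ) (hD : ∃ Y0 : ℕ, ∀ Y ≥ Y0, ∀ t : ℕ, 1 ≤ t → t ≤ Y ^ 14 → ∀ a : ℤ,
    Real.exp (-(Y:ℝ)) ≤ |t * θ - a|) :
    ∃ Y1 : ℕ, ∀ N Y : ℕ, Y1 ≤ Y → Real.exp (8 * Y) ≤ N → 1 + Real.log N ≤ 16 * Y → 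
    ‖∑ n ∈ Finset.Ioc 0 N, (vonMangoldt n : ℂ) * ee (n * θ)‖ ≤ 30000 * N / Y := by
  obtain ⟨Y0, hY0⟩ := hD
  have hev : ∀ᶠ Y : ℕ in atTop, (Y:ℝ)^7 ≤ Real.exp Y := by
    have h1 : ∀ᶠ x : ℝ in atTop, x^7 ≤ Real.exp x := by
      have := (Real.isLittleO_pow_exp_atTop (n := 7)).bound (c := 1) one_pos
      filter_upwards [this, eventually_ge_atTop 0] with x hx hx0
      rw [one_mul, Real.norm_eq_abs, Real.norm_eq_abs, abs_of_nonneg (by positivity), abs_of_pos (Real.exp_pos _)] at hx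
      exact hx
    exact tendsto_natCast_atTop_atTop.eventually h1
  obtain ⟨Y2, hY2⟩ := eventually_atTop.1 hev
  refine ⟨max 2 (max Y0 Y2), fun N Y hY hN hl => ?_⟩
  have a1 : 2 ≤ Y := by omega
  have a2 : Y0 ≤ Y := by omega
  have a3 := hY2 Y (by omega)
  have a1' : (2:ℝ) ≤ Y := by exact_mod_cast a1
  have hX8 : Real.exp Y ^ 8 ≤ N := by
    rw [← Real.exp_nat_mul]; exact_mod_cast hN
  have hX1 : 1 ≤ Real.exp Y := Real.one_le_exp (by positivity)
  have hUU : (Y^7) * (Y^7) ≤ N := by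
    have : ((Y^7 * Y^7 : ℕ) : ℝ) ≤ N := by
      push_cast
      calc (Y:ℝ)^7 * (Y:ℝ)^7 ≤ Real.exp Y * Real.exp Y := by gcongr
        _ = Real.exp Y ^ 2 := by ring
        _ ≤ Real.exp Y ^ 8 := pow_le_pow_right₀ hX1 (by norm_num)
        _ ≤ N := hX8
    exact_mod_cast this
  have hN1 : (1:ℝ) ≤ N := le_trans (one_le_pow₀ hX1) hX8
  have hl2 : Real.log (N + 1 : ℕ) ≤ 16 * Y := by
    refine le_trans ?_ hl
    have : Real.log (N + 1 : ℕ) ≤ Real.log (N * Real.exp 1) := by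
      apply Real.log_le_log
      · positivity
      · push_cast
        have := Real.add_one_le_exp 1
        nlinarith
    rw [Real.log_mul (by positivity) (by positivity), Real.log_exp] at this
    linarith
  have main := vaughan_bound θ (Real.exp (-(Y:ℝ))) (16*Y) (16*Y) (Real.exp_pos _) N (Y^7) 
    (Nat.one_le_pow _ _ (by omega)) hUU
    (fun d h1 h2 a => hY0 Y a2 d h1 (by rw [show Y^14 = Y^7 * Y^7 by ring]; exact h2) a)
    ((harm_le N).trans hl) (by linarith) hl2
  refine main.trans ?_
  rw [Real.exp_neg]
  simp only [div_inv_eq_mul]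
  push_cast
  exact num_bound N Y (Real.exp Y) a1' a3 hX8

open ArithmeticFunction in
theorem S_little (θ : ℝ) (hD : ∃ Y0 : ℕ, ∀ Y ≥ Y0, ∀ t : ℕ, 1 ≤ t → t ≤ Y ^ 14 → ∀ a : ℤ,
    Real.exp (-(Y:ℝ)) ≤ |t * θ - a|) :
    Tendsto (fun N : ℕ => ‖∑ n ∈ Finset.Ioc 0 N, (vonMangoldt n : ℂ) * ee (n * θ)‖ / N) atTop (nhds 0) := by
  obtain ⟨Y1, h⟩ := S_bound θ hD
  have hlog : Tendsto (fun N : ℕ => Real.log N / 8) atTop atTop :=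
    (Real.tendsto_log_atTop.comp tendsto_natCast_atTop_atTop).atTop_div_const (by norm_num)
  have hfl : Tendsto (fun N : ℕ => ⌊Real.log N / 8⌋₊) atTop atTop := tendsto_nat_floor_atTop.comp hlog
  have hlim : Tendsto (fun N : ℕ => 30000 / ((⌊Real.log N / 8⌋₊ : ℕ) : ℝ)) atTop (nhds 0) :=
    (tendsto_const_nhds.div_atTop (tendsto_natCast_atTop_atTop.comp hfl))
  refine squeeze_zero' (Eventually.of_forall fun N => by positivity) ?_ hlim
  filter_upwards [hfl.eventually_ge_atTop Y1, hfl.eventually_ge_atTop 2, eventually_ge_atTop 1] with N h1 h2 h3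
  have hN : (1:ℝ) ≤ N := by exact_mod_cast h3
  have hl0 : 0 ≤ Real.log N / 8 := div_nonneg (Real.log_nonneg hN) (by norm_num)
  have f1 := Nat.floor_le hl0
  have f2 := Nat.lt_floor_add_one (Real.log N / 8)
  have f3 : (2:ℝ) ≤ (⌊Real.log N / 8⌋₊ : ℕ) := by exact_mod_cast h2
  have := h N ⌊Real.log N / 8⌋₊ h1 (by
    rw [← Real.le_log_iff_exp_le (by linarith)]; linarith) (by linarith)
  rw [div_le_iff₀ (by linarith)]
  refine this.trans (le_of_eq ?_)
  ring

theorem card_pi (N : ℕ) : ((Finset.Ioc 0 N).filter Nat.Prime).card = Nat.primeCounting N := by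
  rw [Nat.primeCounting, Nat.primeCounting', Nat.count_eq_card_filter_range]
  congr 1
  ext p
  simp only [Finset.mem_filter, Finset.mem_Ioc, Finset.mem_range]
  constructor
  · rintro ⟨h1, h2⟩; exact ⟨by omega, h2⟩
  · rintro ⟨h1, h2⟩; exact ⟨⟨h2.pos, by omega⟩, h2⟩

open ArithmeticFunction in
theorem psum_bound (θ : ℝ) (N : ℕ) (hN : 1 ≤ N) :
    Real.log N * ‖∑ p ∈ Finset.Ioc 0 N with p.Prime, ee (p * θ)‖ ≤ 
      ‖∑ n ∈ Finset.Ioc 0 N, (vonMangoldt n : ℂ) * ee (n * θ)‖ + (Chebyshev.psi N - Chebyshev.theta N)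
      + (Nat.primeCounting N * Real.log N - Chebyshev.theta N) := by
  have hN' : (1:ℝ) ≤ N := by exact_mod_cast hN
  have h1 : ((Real.log N : ℝ) : ℂ) * ∑ p ∈ Finset.Ioc 0 N with p.Prime, ee (p * θ) = 
      ∑ n ∈ Finset.Ioc 0 N, (vonMangoldt n : ℂ) * ee (n * θ)
      - ∑ n ∈ Finset.Ioc 0 N with ¬ n.Prime, (vonMangoldt n : ℂ) * ee (n * θ)
      + ∑ p ∈ Finset.Ioc 0 N with p.Prime, ((Real.log N - Real.log p : ℝ) : ℂ) * ee (p * θ) := by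
    rw [← Finset.sum_filter_add_sum_filter_not (Finset.Ioc 0 N) Nat.Prime (fun n => (vonMangoldt n : ℂ) * ee (n * θ)),
      add_sub_cancel_right, ← Finset.sum_add_distrib, Finset.mul_sum]
    refine Finset.sum_congr rfl fun p hp => ?_
    rw [vonMangoldt_apply_prime (Finset.mem_filter.1 hp).2]
    push_cast
    ring
  have h2 : ‖∑ n ∈ Finset.Ioc 0 N with ¬ n.Prime, (vonMangoldt n : ℂ) * ee (n * θ)‖ ≤ Chebyshev.psi N - Chebyshev.theta N := by
    rw [Chebyshev.psi_sub_theta_eq_sum_not_prime, Nat.floor_natCast]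
    refine (norm_sum_le _ _).trans (Finset.sum_le_sum fun n _ => ?_)
    rw [norm_mul, ee_norm, mul_one, Complex.norm_real, Real.norm_eq_abs, abs_of_nonneg vonMangoldt_nonneg]
  have h3 : ‖∑ p ∈ Finset.Ioc 0 N with p.Prime, ((Real.log N - Real.log p : ℝ) : ℂ) * ee (p * θ)‖ ≤ 
      Nat.primeCounting N * Real.log N - Chebyshev.theta N := by
    have e : Nat.primeCounting N * Real.log N - Chebyshev.theta N = ∑ p ∈ Finset.Ioc 0 N with p.Prime, (Real.log N - Real.log p) := by
      rw [Finset.sum_sub_distrib, Finset.sum_const, nsmul_eq_mul, card_pi, Chebyshev.theta, Nat.floor_natCast]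
    rw [e]
    refine (norm_sum_le _ _).trans (Finset.sum_le_sum fun p hp => ?_)
    rw [Finset.mem_filter, Finset.mem_Ioc] at hp
    have : Real.log p ≤ Real.log N := Real.log_le_log (by exact_mod_cast hp.1.1) (by exact_mod_cast hp.1.2)
    rw [norm_mul, ee_norm, mul_one, Complex.norm_real, Real.norm_eq_abs, abs_of_nonneg (by linarith)]
  have h4 : Real.log N * ‖∑ p ∈ Finset.Ioc 0 N with p.Prime, ee (p * θ)‖ = 
     ‖((Real.log N : ℝ) : ℂ) * ∑ p ∈ Finset.Ioc 0 N with p.Prime, ee (p * θ)‖ := by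
    rw [norm_mul, Complex.norm_real, Real.norm_eq_abs, abs_of_nonneg (Real.log_nonneg hN')]
  rw [h4, h1]
  refine (norm_add_le _ _).trans ?_
  have := norm_sub_le (∑ n ∈ Finset.Ioc 0 N, (vonMangoldt n : ℂ) * ee (n * θ)) (∑ n ∈ Finset.Ioc 0 N with ¬ n.Prime, (vonMangoldt n : ℂ) * ee (n * θ))
  linarith

theorem log_div_nat : Tendsto (fun N : ℕ => Real.log N / N) atTop (nhds 0) := by
  have := Real.isLittleO_log_id_atTop.tendsto_div_nhds_zero.comp tendsto_natCast_atTop_atTop (α := ℕ)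
  exact this

theorem psum_little (θ : ℝ) (hD : ∃ Y0 : ℕ, ∀ Y ≥ Y0, ∀ t : ℕ, 1 ≤ t → t ≤ Y ^ 14 → ∀ a : ℤ,
    Real.exp (-(Y:ℝ)) ≤ |t * θ - a|) :
    Tendsto (fun N : ℕ => ‖∑ p ∈ Finset.Ioc 0 N with p.Prime, ee (p * θ)‖ / Nat.primeCounting N) atTop (nhds 0) := by
  have hcast : Tendsto (fun N : ℕ => (N:ℝ)) atTop atTop := tendsto_natCast_atTop_atTop
  have t1 := S_little θ hD
  have t2 : Tendsto (fun N : ℕ => 2 * (Real.log N / Real.sqrt N)) atTop (nhds 0) := by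
    have h := (isLittleO_log_rpow_atTop (r := 1/2) (by norm_num)).tendsto_div_nhds_zero.comp hcast
    have h2 := h.const_mul 2
    rw [mul_zero] at h2
    refine h2.congr fun N => ?_
    simp only [Function.comp, Real.sqrt_eq_rpow]
  have t3 : Tendsto (fun N : ℕ => (Nat.primeCounting N * Real.log N - Chebyshev.theta N) / N) atTop (nhds 0) := by
    obtain ⟨C, hC⟩ := Chebyshev.primeCounting_sub_theta_div_log_isBigO.bound
    have hC' := hcast.eventually hC
    have hlim : Tendsto (fun N : ℕ => C * (1 / Real.log N)) atTop (nhds 0) := by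
      have := ((tendsto_const_nhds (x := (1:ℝ))).div_atTop (Real.tendsto_log_atTop.comp hcast)).const_mul C
      rw [mul_zero] at this
      exact this
    refine squeeze_zero_norm' ?_ hlim
    filter_upwards [hC', eventually_ge_atTop 2] with N h hN
    have hN' : (2:ℝ) ≤ N := by exact_mod_cast hN
    have hl : 0 < Real.log N := Real.log_pos (by linarith)
    rw [Nat.floor_natCast] at h
    have e : (Nat.primeCounting N * Real.log N - Chebyshev.theta N) / N = 
        (Nat.primeCounting N - Chebyshev.theta N / Real.log N) * (Real.log N / N) := by
      field_simp
    rw [e, norm_mul]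
    have hp : 0 < Real.log N / N := by positivity
    rw [Real.norm_of_nonneg hp.le]
    refine (mul_le_mul_of_nonneg_right h hp.le).trans (le_of_eq ?_)
    rw [Real.norm_of_nonneg (by positivity)]
    field_simp
  have t4 : ∀ᶠ N : ℕ in atTop, (N:ℝ) / 4 ≤ Nat.primeCounting N * Real.log N := by
    have h := log_div_nat.eventually (gt_mem_nhds (show (0:ℝ) < 1/16 by norm_num))
    filter_upwards [h, eventually_ge_atTop 2] with N h hN
    have hN' : (2:ℝ) ≤ N := by exact_mod_cast hN
    have hl : 0 < Real.log N := Real.log_pos (by linarith)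
    have hp := Chebyshev.pi_ge N
    rw [div_le_iff₀ hl] at hp
    rw [div_lt_iff₀ (by linarith)] at h
    have h5 : Real.log (N + 1) ≤ 2 * Real.log N := by
      rw [← Real.log_rpow (by linarith)]
      apply Real.log_le_log (by linarith)
      norm_num
      nlinarith
    have := Real.log_two_gt_d9
    nlinarith
  have tsum := ((t1.add t2).add t3).const_mul 4
  simp only [add_zero, mul_zero] at tsum
  refine squeeze_zero' (Eventually.of_forall fun N => by positivity) ?_ tsum
  filter_upwards [t4, eventually_ge_atTop 2] with N h4 hN
  have hN' : (2:ℝ) ≤ N := by exact_mod_cast hN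
  have hl : 0 < Real.log N := Real.log_pos (by linarith)
  have hb := psum_bound θ N (by omega)
  have hps := Chebyshev.abs_psi_sub_theta_le_sqrt_mul_log (x := N) (by linarith)
  have hps := (le_abs_self _).trans hps
  have hpi : (0:ℝ) < Nat.primeCounting N := by
    have : 0 < Nat.primeCounting N * Real.log N := by linarith
    exact pos_of_mul_pos_left this hl.le
  have hN0 : (0:ℝ) < N := by linarith
  have hsq : Real.sqrt N * Real.sqrt N = N := Real.mul_self_sqrt hN0.le
  have hs0 : 0 < Real.sqrt N := Real.sqrt_pos.2 hN0
  have e : 2 * (Real.log N / Real.sqrt N) = 2 * Real.sqrt N * Real.log N / N := by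
    have e0 : Real.log N / Real.sqrt N = Real.sqrt N * Real.log N / N := by
      rw [div_eq_div_iff hs0.ne' hN0.ne']
      linear_combination -Real.log N * hsq
    rw [e0]
    ring
  rw [e, ← add_div, ← add_div, div_le_iff₀ hpi]
  set P := ‖∑ p ∈ Finset.Ioc 0 N with p.Prime, ee (p * θ)‖
  set S := ‖∑ n ∈ Finset.Ioc 0 N, (ArithmeticFunction.vonMangoldt n : ℂ) * ee (n * θ)‖
  have hP : 0 ≤ P := norm_nonneg _
  set R := (S + 2 * Real.sqrt N * Real.log N + (Nat.primeCounting N * Real.log N - Chebyshev.theta N)) with hR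
  have hPR : Real.log N * P ≤ R := by linarith
  have hR0 : 0 ≤ R := le_trans (by positivity) hPR
  have : Real.log N * P ≤ Real.log N * (4 * (R / N) * Nat.primeCounting N) := by
    refine hPR.trans ?_
    have e2 : Real.log N * (4 * (R / N) * Nat.primeCounting N) = R * (4 * (Nat.primeCounting N * Real.log N) / N) := by ring
    rw [e2]
    have : 1 ≤ 4 * (Nat.primeCounting N * Real.log N) / N := by
      rw [le_div_iff₀ hN0]; linarith
    nlinarith
  exact le_of_mul_le_mul_left this hl

theorem sum_nth (f : ℕ → ℂ) (n : ℕ) : ∑ p ∈ Finset.range (Nat.nth Nat.Prime n) with p.Prime, f p = 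
    ∑ i ∈ Finset.range n, f (Nat.nth Nat.Prime i) := by
  induction n with
  | zero =>
    rw [Finset.sum_range_zero]
    refine Finset.sum_eq_zero fun p hp => ?_
    rw [Finset.mem_filter, Finset.mem_range, Nat.nth_prime_zero_eq_two] at hp
    have := hp.2.two_le
    omega
  | succ n ih =>
    rw [Nat.filter_range_nth_eq_insert_of_infinite Nat.infinite_setOfPred_prime, Finset.sum_insert, ih, Finset.sum_range_succ, add_comm]
    simp

theorem nth_little (θ : ℝ) (hD : ∃ Y0 : ℕ, ∀ Y ≥ Y0, ∀ t : ℕ, 1 ≤ t → t ≤ Y ^ 14 → ∀ a : ℤ,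
    Real.exp (-(Y:ℝ)) ≤ |t * θ - a|) :
    Tendsto (fun n : ℕ => (∑ i ∈ Finset.range n, ee (Nat.nth Nat.Prime i * θ)) / n) atTop (nhds 0) := by
  rw [tendsto_zero_iff_norm_tendsto_zero]
  have hsm : StrictMono (Nat.nth Nat.Prime) := Nat.nth_strictMono Nat.infinite_setOfPred_prime
  have htop : Tendsto (fun n => Nat.nth Nat.Prime n - 1) atTop atTop :=
    (tendsto_sub_atTop_nat 1).comp hsm.tendsto_atTop
  refine ((psum_little θ hD).comp htop).congr fun n => ?_
  have hp : (Nat.nth Nat.Prime n).Prime := Nat.prime_nth_prime n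
  have h2 := hp.two_le
  have e1 : (Finset.Ioc 0 (Nat.nth Nat.Prime n - 1)).filter Nat.Prime = (Finset.range (Nat.nth Nat.Prime n)).filter Nat.Prime := by
    ext p
    simp only [Finset.mem_filter, Finset.mem_Ioc, Finset.mem_range]
    constructor
    · rintro ⟨h1, h2⟩; exact ⟨by omega, h2⟩
    · rintro ⟨h1, h2⟩; exact ⟨⟨h2.pos, by omega⟩, h2⟩
  have e2 : Nat.primeCounting (Nat.nth Nat.Prime n - 1) = n := by
    rw [Nat.primeCounting, Nat.primeCounting', show Nat.nth Nat.Prime n - 1 + 1 = Nat.nth Nat.Prime n by omega]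
    exact Nat.count_nth_of_infinite Nat.infinite_setOfPred_prime n
  simp only [Function.comp]
  rw [e1, e2, sum_nth (fun p => ee (p * θ)), norm_div, Complex.norm_natCast]

theorem dioph_h (h : ℤ) (hh : h ≠ 0) : ∃ Y0 : ℕ, ∀ Y ≥ Y0, ∀ t : ℕ, 1 ≤ t → t ≤ Y ^ 14 → ∀ a : ℤ,
    Real.exp (-(Y:ℝ)) ≤ |t * (h * Real.logb 10 2) - a| := by
  obtain ⟨Y0, hY0⟩ := dioph 15
  refine ⟨max Y0 h.natAbs, fun Y hY t ht htY a => ?_⟩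
  have h1 : 1 ≤ t * h.natAbs := Nat.mul_pos ht (Int.natAbs_pos.mpr hh)
  have h2 : t * h.natAbs ≤ Y ^ 15 := by
    rw [pow_succ]; exact Nat.mul_le_mul htY (le_trans (le_max_right _ _) hY)
  have h3 := hY0 Y (le_trans (le_max_left _ _) hY) _ h1 h2
  rcases Int.natAbs_eq h with e | e
  · have := h3 a
    have e' : (h:ℝ) = (h.natAbs : ℝ) := by
      have := congrArg (fun z : ℤ => (z:ℝ)) e
      simpa only [Int.cast_natCast] using this
    rw [e']
    convert this using 3
    push_cast; ring
  · have := h3 (-a)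
    have e' : (h:ℝ) = -(h.natAbs : ℝ) := by
      have := congrArg (fun z : ℤ => (z:ℝ)) e
      simpa only [Int.cast_neg, Int.cast_natCast] using this
    rw [e', ← abs_neg]
    convert this using 2
    push_cast; ring

theorem int_fourier (h : ℤ) :
    ∫ t, (fourier h : C(AddCircle (1:ℝ), ℂ)) t ∂AddCircle.haarAddCircle = if h = 0 then 1 else 0 := by
  have := congrFun (fourierCoeff_fourier (T := (1:ℝ)) h) 0
  simp only [fourierCoeff, neg_zero, fourier_zero, one_smul] at this
  rw [this]
  rw [Pi.single_apply]
  simp [eq_comm]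

theorem weyl_cont (x : ℕ → ℝ) (hx : ∀ h : ℤ, h ≠ 0 →
    Tendsto (fun n : ℕ => (∑ i ∈ Finset.range n, ee (h * x i)) / n) atTop (nhds 0))
    (f : C(AddCircle (1:ℝ), ℂ)) :
    Tendsto (fun n : ℕ => (∑ i ∈ Finset.range n, f (x i : AddCircle (1:ℝ))) / n) atTop
      (nhds (∫ t, f t ∂AddCircle.haarAddCircle)) := by
  have hint : ∀ g : C(AddCircle (1:ℝ), ℂ), MeasureTheory.Integrable g (AddCircle.haarAddCircle) := by
    intro g
    exact g.continuous.integrable_of_hasCompactSupport (HasCompactSupport.of_compactSpace _)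
  have hspan : ∀ g ∈ Submodule.span ℂ (Set.range (@fourier (1:ℝ))),
      Tendsto (fun n : ℕ => (∑ i ∈ Finset.range n, g (x i : AddCircle (1:ℝ))) / n) atTop
      (nhds (∫ t, g t ∂AddCircle.haarAddCircle)) := by
    intro g hg
    induction hg using Submodule.span_induction with
    | mem g hg =>
      obtain ⟨h, rfl⟩ := hg
      rw [int_fourier]
      split_ifs with h0
      · subst h0
        refine tendsto_const_nhds.congr' ?_
        filter_upwards [eventually_gt_atTop 0] with n hn
        have : (n:ℂ) ≠ 0 := by exact_mod_cast hn.ne'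
        simp [fourier_zero, this]
      · refine (hx h h0).congr fun n => ?_
        congr 1
        refine Finset.sum_congr rfl fun i _ => ?_
        rw [fourier_coe_apply, ee]
        congr 1
        push_cast
        ring
    | zero => simp
    | add g1 g2 _ _ h1 h2 =>
      have := h1.add h2
      rw [← MeasureTheory.integral_add (hint _) (hint _)] at this
      refine this.congr fun n => ?_
      simp [Finset.sum_add_distrib, add_div]
    | smul c g _ h1 =>
      have := h1.const_mul c
      rw [← MeasureTheory.integral_const_mul] at this
      refine this.congr fun n => ?_
      rw [← mul_div_assoc, Finset.mul_sum]
      simp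
  have hf : f ∈ (Submodule.span ℂ (Set.range (@fourier (1:ℝ)))).topologicalClosure := by
    rw [span_fourier_closure_eq_top]; trivial
  rw [← SetLike.mem_coe, Submodule.topologicalClosure_coe, Metric.mem_closure_iff] at hf
  rw [Metric.tendsto_nhds]
  intro ε hε
  obtain ⟨g, hg, hfg⟩ := hf (ε/3) (by positivity)
  have hpt : ∀ t, ‖f t - g t‖ ≤ ε/3 := by
    intro t
    have := ContinuousMap.dist_apply_le_dist (f := f) (g := g) t
    rw [dist_eq_norm] at this
    linarith
  have := Metric.tendsto_nhds.mp (hspan g hg) (ε/3) (by positivity)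
  filter_upwards [this, eventually_gt_atTop 0] with n hn hn0
  have hn0' : (0:ℝ) < n := by exact_mod_cast hn0
  have a1 : ‖(∑ i ∈ Finset.range n, f (x i : AddCircle (1:ℝ))) / n - (∑ i ∈ Finset.range n, g (x i : AddCircle (1:ℝ))) / n‖ ≤ ε/3 := by
    rw [← sub_div, ← Finset.sum_sub_distrib, norm_div, Complex.norm_natCast, div_le_iff₀ hn0']
    refine (norm_sum_le_of_le _ (fun i _ => hpt _)).trans ?_
    simp [mul_comm]
  have a2 : ‖(∫ t, g t ∂AddCircle.haarAddCircle) - ∫ t, f t ∂AddCircle.haarAddCircle‖ ≤ ε/3 := by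
    rw [← MeasureTheory.integral_sub (hint _) (hint _)]
    have := MeasureTheory.norm_integral_le_of_norm_le_const (μ := @AddCircle.haarAddCircle (1:ℝ) _) (f := fun t => g t - f t) (C := ε/3)
      (Eventually.of_forall fun t => by rw [norm_sub_rev]; exact hpt t)
    simpa using this
  rw [dist_eq_norm] at hn ⊢
  calc _ = ‖((∑ i ∈ Finset.range n, f (x i : AddCircle (1:ℝ))) / n - (∑ i ∈ Finset.range n, g (x i : AddCircle (1:ℝ))) / n) + ((∑ i ∈ Finset.range n, g (x i : AddCircle (1:ℝ))) / n - (∫ t, g t ∂AddCircle.haarAddCircle)) + ((∫ t, g t ∂AddCircle.haarAddCircle) - ∫ t, f t ∂AddCircle.haarAddCircle)‖ := by congr 1; ring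
    _ ≤ _ := norm_add₃_le
    _ < ε := by linarith

theorem pt_null (z : AddCircle (1:ℝ)) : (AddCircle.haarAddCircle (T := (1:ℝ))) {z} = 0 := by
  have := AddCircle.add_projection_respects_measure (1:ℝ) 0 (MeasurableSet.singleton z)
  rw [AddCircle.volume_eq_smul_haarAddCircle] at this
  simp only [ENNReal.ofReal_one, one_smul] at this
  rw [this]
  refine Set.Subsingleton.measure_zero ?_ _
  rintro a ⟨ha, ha'⟩ b ⟨hb, hb'⟩
  have hab : (a : AddCircle (1:ℝ)) = b := by
    have h1 : (a : AddCircle (1:ℝ)) = z := ha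
    have h2 : (b : AddCircle (1:ℝ)) = z := hb
    rw [h1, h2]
  exact (AddCircle.coe_eq_coe_iff_of_mem_Ioc ha' hb').mp hab

theorem arc_frontier (α β : ℝ) : (AddCircle.haarAddCircle (T := (1:ℝ)))
    (frontier ((fun y : ℝ => (y : AddCircle (1:ℝ))) '' Set.Ioo α β)) = 0 := by
  have hopen : IsOpen ((fun y : ℝ => (y : AddCircle (1:ℝ))) '' Set.Ioo α β) :=
    QuotientAddGroup.isOpenMap_coe _ isOpen_Ioo
  have hcl : IsClosed ((fun y : ℝ => (y : AddCircle (1:ℝ))) '' Set.Icc α β) :=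
    (isCompact_Icc.image (AddCircle.continuous_mk' 1)).isClosed
  have hsub : frontier ((fun y : ℝ => (y : AddCircle (1:ℝ))) '' Set.Ioo α β) ⊆ {(α : AddCircle (1:ℝ)), (β : AddCircle (1:ℝ))} := by
    rw [hopen.frontier_eq]
    rintro z ⟨hz, hz2⟩
    have : z ∈ ((fun y : ℝ => (y : AddCircle (1:ℝ))) '' Set.Icc α β) :=
      closure_minimal (Set.image_mono Set.Ioo_subset_Icc_self) hcl hz
    obtain ⟨y, hy, rfl⟩ := this
    by_cases h1 : y = α
    · left; rw [h1]
    by_cases h2 : y = β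
    · right; rw [h2]; rfl
    exact absurd ⟨y, ⟨lt_of_le_of_ne hy.1 (Ne.symm h1), lt_of_le_of_ne hy.2 h2⟩, rfl⟩ hz2
  exact MeasureTheory.measure_mono_null hsub (by
    rw [Set.insert_eq]; exact MeasureTheory.measure_union_null (pt_null _) (pt_null _))

theorem arc_measure (α β : ℝ) (h0 : 0 ≤ α) (hαβ : α ≤ β) (h1 : β ≤ 1) : (AddCircle.haarAddCircle (T := (1:ℝ)))
    (((fun y : ℝ => (y : AddCircle (1:ℝ))) '' Set.Ioo α β)) = ENNReal.ofReal (β - α) := by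
  have hopen : IsOpen ((fun y : ℝ => (y : AddCircle (1:ℝ))) '' Set.Ioo α β) :=
    QuotientAddGroup.isOpenMap_coe _ isOpen_Ioo
  have := AddCircle.add_projection_respects_measure (1:ℝ) 0 hopen.measurableSet
  rw [AddCircle.volume_eq_smul_haarAddCircle] at this
  simp only [ENNReal.ofReal_one, one_smul] at this
  rw [this, ← Real.volume_Ioo]
  congr 1
  ext y
  constructor
  · rintro ⟨⟨z, hz, hzy⟩, hy⟩
    have : z = y := by
      have hz' : z ∈ Set.Ioc (0:ℝ) (0+1) := ⟨by linarith [hz.1], by linarith [hz.2]⟩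
      have := (AddCircle.coe_eq_coe_iff_of_mem_Ioc hz' hy).mp hzy
      exact this
    rwa [← this]
  · intro hy
    exact ⟨⟨y, hy, rfl⟩, by linarith [hy.1], by linarith [hy.2]⟩

open Classical in
theorem weyl_arc (x : ℕ → ℝ) (hx : ∀ h : ℤ, h ≠ 0 →
    Tendsto (fun n : ℕ => (∑ i ∈ Finset.range n, ee (h * x i)) / n) atTop (nhds 0))
    (α β : ℝ) (h0 : 0 ≤ α) (hαβ : α ≤ β) (h1 : β ≤ 1) :
    Tendsto (fun n : ℕ => (((Finset.range n).filter (fun i => (x i : AddCircle (1:ℝ)) ∈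
      ((fun y : ℝ => (y : AddCircle (1:ℝ))) '' Set.Ioo α β))).card : ℝ) / n) atTop
      (nhds (β - α)) := by
  rw [← tendsto_add_atTop_iff_nat 1]
  set E := ((fun y : ℝ => (y : AddCircle (1:ℝ))) '' Set.Ioo α β) with hE
  have hopen : IsOpen E :=
    QuotientAddGroup.isOpenMap_coe _ isOpen_Ioo
  let m : ℕ → MeasureTheory.Measure (AddCircle (1:ℝ)) := fun n =>
    ((n+1 : ℕ) : ENNReal)⁻¹ • ∑ i ∈ Finset.range (n+1), MeasureTheory.Measure.dirac (x i : AddCircle (1:ℝ))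
  have hm : ∀ n, MeasureTheory.IsProbabilityMeasure (m n) := by
    intro n
    constructor
    simp only [m, MeasureTheory.Measure.smul_apply, MeasureTheory.Measure.finsetSum_apply, MeasureTheory.measure_univ]
    simp only [Finset.sum_const, Finset.card_range, nsmul_eq_mul, mul_one, smul_eq_mul]
    exact ENNReal.inv_mul_cancel (by simp) (by simp)
  let P : ℕ → MeasureTheory.ProbabilityMeasure (AddCircle (1:ℝ)) := fun n => ⟨m n, hm n⟩
  let H : MeasureTheory.ProbabilityMeasure (AddCircle (1:ℝ)) := ⟨AddCircle.haarAddCircle, inferInstance⟩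
  have hconv : Tendsto P atTop (nhds H) := by
    rw [MeasureTheory.ProbabilityMeasure.tendsto_iff_forall_integral_rclike_tendsto ℂ]
    intro f
    have := (tendsto_add_atTop_iff_nat 1).mpr (weyl_cont x hx f.toContinuousMap)
    refine this.congr fun n => ?_
    show _ = ∫ ω, f ω ∂(m n)
    simp only [m]
    rw [MeasureTheory.integral_smul_measure, MeasureTheory.integral_finsetSum_measure]
    · simp only [MeasureTheory.integral_dirac]
      rw [ENNReal.toReal_inv, ENNReal.toReal_natCast, div_eq_inv_mul, Complex.real_smul]
      push_cast
      rfl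
    · intro i _
      exact f.integrable _
  have := MeasureTheory.ProbabilityMeasure.tendsto_measure_of_null_frontier_of_tendsto' hconv (E := E) (arc_frontier α β)
  have h2 : Tendsto (fun n => m n E) atTop (nhds (ENNReal.ofReal (β - α))) := by
    rw [← arc_measure α β h0 hαβ h1]; exact this
  have h3 := (ENNReal.tendsto_toReal ENNReal.ofReal_ne_top).comp h2
  rw [ENNReal.toReal_ofReal (by linarith)] at h3
  refine h3.congr fun n => ?_
  simp only [m, Function.comp, MeasureTheory.Measure.smul_apply, MeasureTheory.Measure.finsetSum_apply,
    MeasureTheory.Measure.dirac_apply' _ hopen.measurableSet, Set.indicator_apply, Pi.one_apply]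
  rw [Finset.sum_boole, smul_eq_mul, ENNReal.toReal_mul, ENNReal.toReal_inv, ENNReal.toReal_natCast,
    ENNReal.toReal_natCast, div_eq_inv_mul]

theorem digit_iff (p d : ℕ) (hp : 4 ≤ p) (hd1 : 1 ≤ d) (hd9 : d ≤ 9) :
    HasLeadingDigit ((2:ℝ)^p - 1) d ↔ (((p * Real.logb 10 2 : ℝ)) : AddCircle (1:ℝ)) ∈
      ((fun y : ℝ => (y : AddCircle (1:ℝ))) '' Set.Ioo (Real.logb 10 d) (Real.logb 10 ((d:ℝ)+1))) := by
  have h16 : (16:ℝ) ≤ 2^p := by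
    calc (16:ℝ) = 2^4 := by norm_num
      _ ≤ 2^p := pow_le_pow_right₀ (by norm_num) hp
  have hd1' : (1:ℝ) ≤ d := by exact_mod_cast hd1
  have hd9' : (d:ℝ) ≤ 9 := by exact_mod_cast hd9
  have hpos : (0:ℝ) < 2^p := by positivity
  have hpL : (p:ℝ) * Real.logb 10 2 = Real.logb 10 (2^p) := by rw [Real.logb_pow]
  have hk : ∀ k : ℤ, (2:ℝ)^p - 1 < ((d:ℝ)+1)*10^k → ∃ m : ℕ, k = (m:ℤ) ∧ 1 ≤ m := by
    intro k hk
    have h1 : 1 ≤ k := by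
      by_contra hc
      have : (10:ℝ)^k ≤ 1 := zpow_le_one_of_nonpos₀ (by norm_num) (by omega)
      have : ((d:ℝ)+1)*10^k ≤ 10*1 := by
        have h0 : (0:ℝ) < 10^k := by positivity
        nlinarith
      linarith
    exact ⟨k.toNat, by omega, by omega⟩
  have hL : ∀ (k : ℤ) (c : ℝ), 0 < c → Real.logb 10 (c * 10^k) = Real.logb 10 c + k := by
    intro k c hc
    rw [Real.logb_mul hc.ne' (by positivity), ← Real.rpow_intCast, Real.logb_rpow (by norm_num) (by norm_num)]
  constructor
  · rintro ⟨k, h1, h2⟩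
    obtain ⟨m, rfl, hm⟩ := hk k h2
    have h3 : 2^p ≠ (d+1) * 10^m := by
      intro h
      have h5 : 5 ∣ 2^p := by
        rw [h]
        exact Dvd.dvd.mul_left (dvd_pow (by norm_num) (by omega)) _
      have := (Nat.Prime.dvd_of_dvd_pow (by norm_num) h5)
      omega
    have h4 : 2^p ≤ (d+1) * 10^m := by
      have : (2:ℝ)^p < (((d+1)*10^m + 1 : ℕ) : ℝ) := by
        push_cast
        rw [zpow_natCast] at h2
        linarith
      have : 2^p < (d+1)*10^m + 1 := by exact_mod_cast this
      omega
    have h5 : (2:ℝ)^p < ((d:ℝ)+1) * 10^(m:ℤ) := by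
      rw [zpow_natCast]
      exact_mod_cast lt_of_le_of_ne h4 h3
    have h6 : (d:ℝ) * 10^(m:ℤ) < 2^p := by linarith
    refine ⟨p * Real.logb 10 2 - m, ⟨?_, ?_⟩, ?_⟩
    · have := Real.logb_lt_logb (b := 10) (by norm_num) (by positivity) h6
      rw [hL _ _ (by linarith)] at this
      rw [hpL]; push_cast at this; linarith
    · have := Real.logb_lt_logb (b := 10) (by norm_num) (by positivity) h5
      rw [hL _ _ (by linarith)] at this
      rw [hpL]; push_cast at this; linarith
    · show ((p * Real.logb 10 2 - m : ℝ) : AddCircle (1:ℝ)) = _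
      rw [← sub_eq_zero, ← AddCircle.coe_sub, AddCircle.coe_eq_zero_iff]
      exact ⟨-(m:ℤ), by simp⟩
  · rintro ⟨y, ⟨hy1, hy2⟩, hy⟩
    have hy' : ((y : ℝ) : AddCircle (1:ℝ)) = ((p * Real.logb 10 2 : ℝ) : AddCircle (1:ℝ)) := hy
    rw [eq_comm, ← sub_eq_zero, ← AddCircle.coe_sub, AddCircle.coe_eq_zero_iff] at hy'
    obtain ⟨k, hk'⟩ := hy'
    simp only [zsmul_eq_mul, mul_one] at hk'
    have e1 : Real.logb 10 ((d:ℝ) * 10^k) < Real.logb 10 (2^p) := by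
      rw [hL _ _ (by linarith), ← hpL]; linarith
    have e2 : Real.logb 10 (2^p) < Real.logb 10 (((d:ℝ)+1) * 10^k) := by
      rw [hL _ _ (by linarith), ← hpL]; linarith
    rw [Real.logb_lt_logb_iff (by norm_num) (by positivity) (by positivity)] at e1 e2
    obtain ⟨m, rfl, hm⟩ := hk k (by linarith)
    refine ⟨m, ?_, by linarith⟩
    rw [zpow_natCast] at e1 ⊢
    have e3 : d * 10^m < 2^p := by exact_mod_cast e1
    have e4 : d * 10^m + 1 ≤ 2^p := e3
    have e5 : (d:ℝ) * 10^m + 1 ≤ 2^p := by exact_mod_cast e4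
    linarith

open Classical in
theorem count_limit (A B : ℕ → Prop) (l : ℝ) (hAB : ∀ i, 2 ≤ i → (A i ↔ B i))
    (hB : Tendsto (fun n : ℕ => (((Finset.range n).filter B).card : ℝ) / n) atTop (nhds l)) :
    Tendsto (fun n : ℕ => (((Finset.range n).filter A).card : ℝ) / n) atTop (nhds l) := by
  have key : ∀ A B : ℕ → Prop, (∀ i, 2 ≤ i → (A i ↔ B i)) → ∀ n,
      ((Finset.range n).filter A).card ≤ ((Finset.range n).filter B).card + 2 := by
    intro A B h n
    have : (Finset.range n).filter A ⊆ (Finset.range n).filter B ∪ Finset.range 2 := by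
      intro i hi
      simp only [Finset.mem_filter, Finset.mem_union, Finset.mem_range] at hi ⊢
      by_cases h2 : i < 2
      · exact Or.inr h2
      · exact Or.inl ⟨hi.1, (h i (by omega)).mp hi.2⟩
    have h1 := (Finset.card_le_card this).trans (Finset.card_union_le _ _)
    simpa using h1
  have h2 : Tendsto (fun n : ℕ => (2:ℝ) / n) atTop (nhds 0) := tendsto_const_div_atTop_nhds_zero_nat 2
  have hlo := hB.sub h2
  have hhi := hB.add h2
  rw [sub_zero] at hlo
  rw [add_zero] at hhi
  refine tendsto_of_tendsto_of_tendsto_of_le_of_le hlo hhi (fun n => ?_) (fun n => ?_)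
  · show _ / _ - _ / _ ≤ _ / _
    rw [← sub_div]
    have := key B A (fun i hi => (hAB i hi).symm) n
    have : (((Finset.range n).filter B).card : ℝ) ≤ ((Finset.range n).filter A).card + 2 := by exact_mod_cast this
    gcongr
    linarith
  · show _ / _ ≤ _ / _ + _ / _
    rw [← add_div]
    have := key A B hAB n
    have : (((Finset.range n).filter A).card : ℝ) ≤ ((Finset.range n).filter B).card + 2 := by exact_mod_cast this
    gcongr

/-- The Mersenne numbers `M_n = 2^{p_n} - 1` satisfy Benford's Law. -/
theorem mersenne_benford :
    BenfordDistributed (fun n : ℕ => (2 : ℝ) ^ nthPrime n - 1) := by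
  classical
  intro d hd1 hd9
  have hd1' : (1:ℝ) ≤ d := by exact_mod_cast hd1
  have hd9' : (d:ℝ) ≤ 9 := by exact_mod_cast hd9
  have hW := weyl_arc (fun i => (Nat.nth Nat.Prime i : ℝ) * Real.logb 10 2) (by
    intro h hh
    refine (nth_little _ (dioph_h h hh)).congr fun n => ?_
    congr 1
    refine Finset.sum_congr rfl fun i _ => ?_
    congr 1
    ring) (Real.logb 10 d) (Real.logb 10 ((d:ℝ)+1))
    (Real.logb_nonneg (by norm_num) hd1')
    (Real.logb_le_logb_of_le (by norm_num) (by linarith) (by linarith))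
    (by
      have := Real.logb_le_logb_of_le (b := 10) (by norm_num) (by linarith : (0:ℝ) < (d:ℝ)+1) (by linarith : (d:ℝ)+1 ≤ 10)
      rwa [Real.logb_self_eq_one (by norm_num)] at this)
  have hval : Real.logb 10 ((d:ℝ)+1) - Real.logb 10 d = benfordP d := by
    rw [benfordP, ← Real.logb_div (by linarith) (by linarith)]
    congr 1
    have : (d:ℝ) ≠ 0 := by linarith
    field_simp
  rw [hval] at hW
  have hC := count_limit (fun i => HasLeadingDigit ((2:ℝ) ^ Nat.nth Nat.Prime i - 1) d) _ _ (fun i hi =>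
    digit_iff (Nat.nth Nat.Prime i) d (by have := Nat.add_two_le_nth_prime i; omega) hd1 hd9) hW
  refine hC.congr fun N => ?_
  congr 2
  have hset : {n : ℕ | 1 ≤ n ∧ n ≤ N ∧ HasLeadingDigit ((2 : ℝ) ^ nthPrime n - 1) d} =
      (((Finset.range N).filter (fun i => HasLeadingDigit ((2:ℝ) ^ Nat.nth Nat.Prime i - 1) d)).image
        Nat.succ : Finset ℕ) := by
    ext n
    simp only [Set.mem_setOf_eq, Finset.coe_image, Set.mem_image, Finset.mem_coe, Finset.mem_filter, Finset.mem_range]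
    constructor
    · rintro ⟨h1, h2, h3⟩
      exact ⟨n - 1, ⟨by omega, h3⟩, by omega⟩
    · rintro ⟨i, ⟨h1, h2⟩, rfl⟩
      exact ⟨by omega, by omega, h2⟩
  rw [hset, Nat.card_eq_card_toFinset, Finset.toFinset_coe, Finset.card_image_of_injective _ Nat.succ_injective]
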